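/- arXiv:2209.04658 — 6 statements merged into one kernel-verified Lean document; each statement's English description precedes it below -/
import Mathlib

section
/- For every smooth compactly supported function φ : ℝ → ℂ, the function 𝒫̂_φ(z) := ∫_ℝ 𝔖_t(z) φ(t) dt, restricted to the real line, belongs to L²(ℝ). -/
open MeasureTheory Real Complex Filter Set

noncomputable section

/-- The von Mangoldt function. -/
def vM (n : ℕ) : ℝ := ArithmeticFunction.vonMangoldt n

/-- The logarithmic derivative `Γ'/Γ` of the complex Gamma function. -/
def digamma (s : ℂ) : ℂ := deriv Complex.Gamma s / Complex.Gamma s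

/-- The logarithmic derivative `Γ'/Γ` of the real Gamma function. -/
def digammaR (x : ℝ) : ℝ := deriv Real.Gamma x / Real.Gamma x

/-- The Hurwitz–Lerch zeta function `Φ(z,s,a) = ∑_{n≥0} z^n (n+a)^{-s}`, real version. -/
def PhiR (z s a : ℝ) : ℝ := ∑' n : ℕ, z ^ n / ((n : ℝ) + a) ^ s

/-- The Hurwitz–Lerch zeta function `Φ(z,s,a) = ∑_{n≥0} z^n (n+a)^{-s}`, complex version. -/
def PhiC (z s a : ℂ) : ℂ := ∑' n : ℕ, z ^ n / ((n : ℂ) + a) ^ s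

/-- The screw function `g(t)`, extended evenly to all of `ℝ`. -/
def g (t : ℝ) : ℝ :=
  -4 * (Real.exp (|t| / 2) + Real.exp (-|t| / 2) - 2)
    - |t| / 2 * (digammaR (1 / 4) - Real.log π)
    - (1 / 4) * (PhiR 1 2 (1 / 4) - Real.exp (-|t| / 2) * PhiR (Real.exp (-2 * |t|)) 2 (1 / 4))
    + ∑ n ∈ Finset.Icc 1 ⌊Real.exp |t|⌋₊, vM n / Real.sqrt n * (|t| - Real.log n)

/-- `Z(s) = π^{-s/2} Γ(s/2) ζ(s)`. -/
def Zfun (s : ℂ) : ℂ := (π : ℂ) ^ (-s / 2) * Complex.Gamma (s / 2) * riemannZeta s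

/-- The function `𝔓_t(z)` (for `t ≥ 0`). -/
def Pfrak (t : ℝ) (z : ℂ) : ℂ :=
  4 * ((Real.exp (t / 2) : ℂ) - 1) / (1 - 2 * I * z)
    + 4 * ((Real.exp (-t / 2) : ℂ) - 1) / (1 + 2 * I * z)
    - ∑ n ∈ Finset.Icc 1 ⌊Real.exp t⌋₊,
        ((vM n / Real.sqrt n : ℝ) : ℂ) *
          ((Complex.exp (I * z * ((t : ℝ) - Real.log n)) - 1) / (I * z))
    + (Complex.exp (I * t * z) - 1) / (I * z) *
        (deriv Zfun (1 / 2 - I * z) / Zfun (1 / 2 - I * z) - (1 / 2) * (Real.log π : ℂ)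
          + (1 / 2) * _root_.digamma (1 / 4 + I * z / 2))
    - 1 / (2 * I * z) * (_root_.digamma (1 / 4) - _root_.digamma (1 / 4 + I * z / 2))
    - 1 / (2 * I * z) * (Real.exp (-t / 2) : ℂ) *
        (PhiC (Real.exp (-2 * t)) 1 (1 / 4) - PhiC (Real.exp (-2 * t)) 1 ((1 / 2 + I * z) / 2))

/-- The Riemann xi function `ξ(s) = (1/2)s(s-1)π^{-s/2}Γ(s/2)ζ(s)`. -/
def xi (s : ℂ) : ℂ := s * (s - 1) / 2 * (π : ℂ) ^ (-s / 2) * Complex.Gamma (s / 2) * riemannZeta s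

/-- `E(z) = ξ(1/2-iz) + ξ'(1/2-iz)`. -/
def Efun (z : ℂ) : ℂ := xi (1 / 2 - I * z) + deriv xi (1 / 2 - I * z)

/-- `Θ(z) = conj(E(conj z)) / E(z)`. -/
def Theta (z : ℂ) : ℂ := (starRingEnd ℂ) (Efun ((starRingEnd ℂ) z)) / Efun z

/-- The screw line `𝔖_t(z)`, extended to negative `t` by `𝔖_{-t} = 𝔖_t`. -/
def Sfrak (t : ℝ) (z : ℂ) : ℂ := I * (1 + Theta z) / (2 * (Real.sqrt π : ℂ)) * Pfrak |t| z

/-- The entire function `z ↦ ξ(1/2 - iz)`. -/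
def xiShift (z : ℂ) : ℂ := xi (1 / 2 - I * z)

/-- The set of zeros of `z ↦ ξ(1/2 - iz)` (not counting multiplicity). -/
def XiZeros : Set ℂ := {z | xiShift z = 0}

/-- The multiplicity of a zero of `z ↦ ξ(1/2 - iz)`. -/
def mult (γ : ℂ) : ℕ := sInf {n : ℕ | iteratedDeriv n xiShift γ ≠ 0}

/-- The kernel `G_g(t,u) = g(t-u) - g(t) - g(u) + g(0)`. -/
def Gg (t u : ℝ) : ℝ := g (t - u) - g t - g u + g 0

/-- `𝒫̂_φ(z) = ∫_ℝ 𝔖_t(z) φ(t) dt`. -/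
def Phat (φ : ℝ → ℂ) (z : ℂ) : ℂ := ∫ t : ℝ, Sfrak t z * φ t

/-- The Fourier-type transform `φ̂(z) = ∫_ℝ φ(t) e^{izt} dt`. -/
def FT (φ : ℝ → ℂ) (z : ℂ) : ℂ := ∫ t : ℝ, φ t * Complex.exp (I * z * t)

section Measurability

theorem measurable_complexGamma : Measurable Complex.Gamma := by
  have h : Measurable fun s : ℂ => (Complex.Gamma s)⁻¹ :=
    Complex.differentiable_one_div_Gamma.continuous.measurable
  simpa [Pi.inv_def] using h.inv

theorem measurable_riemannZeta : Measurable riemannZeta :=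
  measurable_of_continuousOn_compl_singleton 1 differentiableOn_riemannZeta.continuousOn

theorem measurable_digamma : Measurable _root_.digamma :=
  (measurable_deriv _).div measurable_complexGamma

theorem measurable_Zfun : Measurable Zfun := by
  have := measurable_complexGamma
  have := measurable_riemannZeta
  unfold Zfun
  fun_prop

theorem measurable_xi : Measurable xi := by
  have := measurable_complexGamma
  have := measurable_riemannZeta
  unfold xi
  fun_prop

theorem measurable_Theta : Measurable Theta := by
  have := measurable_xi
  have : Measurable Efun := by
    unfold Efun
    fun_prop
  have : Measurable (starRingEnd ℂ) := Complex.continuous_conj.measurable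
  unfold Theta
  fun_prop

theorem measurable_Pfrak : Measurable fun p : ℂ × ℝ => Pfrak p.2 p.1 := by
  have := measurable_digamma
  have := measurable_Zfun
  have hΦ : Measurable fun p : ℂ × ℂ => PhiC p.1 1 p.2 := by
    unfold PhiC
    fun_prop
  have h₁ : Measurable fun p : ℂ × ℝ => PhiC (Real.exp (-2 * p.2)) 1 (1 / 4) :=
    hΦ.comp (f := fun p : ℂ × ℝ => ((Real.exp (-2 * p.2) : ℂ), (1 / 4 : ℂ))) (by fun_prop)
  have h₂ : Measurable fun p : ℂ × ℝ => PhiC (Real.exp (-2 * p.2)) 1 ((1 / 2 + I * p.1) / 2) :=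
    hΦ.comp (f := fun p : ℂ × ℝ => ((Real.exp (-2 * p.2) : ℂ), (1 / 2 + I * p.1) / 2))
      (by fun_prop)
  have h₃ : Measurable fun p : ℂ × ℝ => ∑ n ∈ Finset.Icc 1 ⌊Real.exp p.2⌋₊,
      ((vM n / Real.sqrt n : ℝ) : ℂ) *
        ((Complex.exp (I * p.1 * ((p.2 : ℝ) - Real.log n)) - 1) / (I * p.1)) := by
    have h : Measurable fun q : (ℂ × ℝ) × ℕ => ∑ n ∈ Finset.Icc 1 q.2,
        ((vM n / Real.sqrt n : ℝ) : ℂ) *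
          ((Complex.exp (I * q.1.1 * ((q.1.2 : ℝ) - Real.log n)) - 1) / (I * q.1.1)) :=
      measurable_from_prod_countable_left fun N => by
        simp only
        exact Finset.measurable_fun_sum _ fun n _ => by fun_prop
    exact h.comp (f := fun p : ℂ × ℝ => (p, ⌊Real.exp p.2⌋₊))
      (measurable_id.prodMk (Nat.measurable_floor.comp (by fun_prop)))
  unfold Pfrak
  fun_prop

theorem measurable_Sfrak : Measurable fun p : ℂ × ℝ => Sfrak p.2 p.1 := by
  have := measurable_Theta
  have h : Measurable fun p : ℂ × ℝ => Pfrak |p.2| p.1 :=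
    measurable_Pfrak.comp (f := fun p : ℂ × ℝ => (p.1, |p.2|)) (by fun_prop)
  unfold Sfrak
  fun_prop

end Measurability

section CriticalLine

theorem Zfun_eq_completedRiemannZeta {s : ℂ} (hs : 0 < s.re) :
    Zfun s = completedRiemannZeta s := by
  have h0 : s ≠ 0 := by rintro rfl; simp at hs
  have := Gammaℝ_ne_zero_of_re_pos hs
  rw [Zfun, riemannZeta_def_of_ne_zero h0, ← Gammaℝ_def]
  field_simp

theorem xi_eq_mul_Zfun (s : ℂ) : xi s = s * (s - 1) / 2 * Zfun s := by
  rw [xi, Zfun]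
  ring

theorem Zfun_conj (s : ℂ) : Zfun ((starRingEnd ℂ) s) = (starRingEnd ℂ) (Zfun s) := by
  have hπ : (π : ℂ).arg ≠ π := by
    rw [Complex.arg_ofReal_of_nonneg Real.pi_pos.le]
    exact Real.pi_pos.ne
  have h1 : (π : ℂ) ^ (-(starRingEnd ℂ) s / 2) = (starRingEnd ℂ) ((π : ℂ) ^ (-s / 2)) := by
    have := Complex.cpow_conj (π : ℂ) (-s / 2) hπ
    simpa [map_ofNat] using this
  have h2 : Complex.Gamma ((starRingEnd ℂ) s / 2) = (starRingEnd ℂ) (Complex.Gamma (s / 2)) := by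
    rw [← Complex.Gamma_conj]
    simp [map_ofNat]
  simp only [Zfun, map_mul, h1, h2, riemannZeta_conj]

theorem xi_conj (s : ℂ) : xi ((starRingEnd ℂ) s) = (starRingEnd ℂ) (xi s) := by
  simp [xi_eq_mul_Zfun, Zfun_conj, map_ofNat]

theorem xi_one_sub {s : ℂ} (hs : 0 < s.re) (hs' : s.re < 1) : xi (1 - s) = xi s := by
  rw [xi_eq_mul_Zfun, xi_eq_mul_Zfun, Zfun_eq_completedRiemannZeta hs,
    Zfun_eq_completedRiemannZeta (by simpa using hs'), completedRiemannZeta_one_sub]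
  ring

theorem differentiableAt_Zfun {s : ℂ} (hs : 0 < s.re) (hs' : s ≠ 1) :
    DifferentiableAt ℂ Zfun s := by
  have h0 : s ≠ 0 := by rintro rfl; simp at hs
  refine (differentiableAt_completedZeta h0 hs').congr_of_eventuallyEq ?_
  filter_upwards [(isOpen_lt continuous_const Complex.continuous_re).mem_nhds hs] with w hw
  exact Zfun_eq_completedRiemannZeta hw

theorem hasDerivAt_xi {s : ℂ} (hs : 0 < s.re) (hs' : s ≠ 1) :
    HasDerivAt xi ((2 * s - 1) / 2 * Zfun s + s * (s - 1) / 2 * deriv Zfun s) s := by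
  have h : xi = fun w => w * (w - 1) / 2 * Zfun w := funext xi_eq_mul_Zfun
  rw [h]
  have h1 := (((hasDerivAt_id s).mul ((hasDerivAt_id s).sub_const 1)).div_const 2).mul
    (differentiableAt_Zfun hs hs').hasDerivAt
  refine h1.congr_deriv ?_
  simp only [Pi.mul_apply, id]
  ring

theorem critical_re (x : ℝ) : (1 / 2 - I * x : ℂ).re = 1 / 2 := by simp

theorem critical_ne_zero (x : ℝ) : (1 / 2 - I * x : ℂ) ≠ 0 := fun h => by
  have := congrArg Complex.re h
  norm_num at this

theorem critical_ne_one (x : ℝ) : (1 / 2 - I * x : ℂ) ≠ 1 := fun h => by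
  have := congrArg Complex.re h
  norm_num at this

theorem xi_critical_im (x : ℝ) : (xi (1 / 2 - I * x)).im = 0 := by
  have h1 : (starRingEnd ℂ) (1 / 2 - I * x : ℂ) = 1 - (1 / 2 - I * x) := by
    simp [map_ofNat]
    ring
  have h2 := xi_conj (1 / 2 - I * x)
  rw [h1, xi_one_sub (by norm_num) (by norm_num)] at h2
  exact Complex.conj_eq_iff_im.1 h2.symm

theorem deriv_xi_critical_re (x : ℝ) : (deriv xi (1 / 2 - I * x)).re = 0 := by
  have hd := (hasDerivAt_xi (s := 1 / 2 - I * x) (by norm_num) (critical_ne_one x)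
    ).differentiableAt.hasDerivAt
  have hl : HasDerivAt (fun y : ℝ => (1 / 2 - I * y : ℂ)) (-I) x := by
    simpa using ((Complex.ofRealCLM.hasDerivAt (x := x)).const_mul I).const_sub (1 / 2 : ℂ)
  have hc : HasDerivAt (fun y : ℝ => xi (1 / 2 - I * y)) (deriv xi (1 / 2 - I * x) * -I) x :=
    HasDerivAt.comp (h₂ := xi) x hd hl
  have him := Complex.imCLM.hasFDerivAt.comp_hasDerivAt x hc
  have hz : (Complex.imCLM ∘ fun y : ℝ => xi (1 / 2 - I * y)) = fun _ => (0 : ℝ) :=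
    funext fun y => xi_critical_im y
  rw [hz] at him
  have := him.unique (hasDerivAt_const x (0 : ℝ))
  simpa using this

theorem norm_Theta_ofReal_le (x : ℝ) : ‖Theta x‖ ≤ 1 := by
  rw [Theta, Complex.conj_ofReal, norm_div, Complex.norm_conj]
  exact div_self_le_one _

theorem norm_one_add_Theta_ofReal_le (x : ℝ) : ‖1 + Theta x‖ ≤ 2 := by
  have := norm_add_le 1 (Theta x)
  have := norm_Theta_ofReal_le x
  simp at *
  linarith

theorem one_add_Theta_mul_Efun (x : ℝ) (hE : Efun x ≠ 0) :
    (1 + Theta x) * Efun x = 2 * xi (1 / 2 - I * x) := by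
  have h1 := xi_critical_im x
  have h2 := deriv_xi_critical_re x
  rw [Theta, Complex.conj_ofReal, add_mul, div_mul_cancel₀ _ hE, Efun]
  apply Complex.ext <;> simp at * <;> linarith

theorem norm_one_add_Theta_mul_logDeriv_le (x : ℝ) :
    ‖(1 + Theta x) * (deriv Zfun (1 / 2 - I * x) / Zfun (1 / 2 - I * x))‖ ≤ 10 := by
  have hs0 := critical_ne_zero x
  have hs1 := critical_ne_one x
  have hre := critical_re x
  have him := xi_critical_im x
  have hdre := deriv_xi_critical_re x
  have hθ := one_add_Theta_mul_Efun x
  have hn := norm_one_add_Theta_ofReal_le x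
  have hE : Efun x = xi (1 / 2 - I * x) + deriv xi (1 / 2 - I * x) := rfl
  have hd := (hasDerivAt_xi (s := 1 / 2 - I * x) (by norm_num) hs1).deriv
  have hxi := xi_eq_mul_Zfun (1 / 2 - I * x)
  generalize (1 / 2 - I * x : ℂ) = s at *
  by_cases hZ : Zfun s = 0
  · simp [hZ]
  have hs1' : s - 1 ≠ 0 := sub_ne_zero.2 hs1
  have hxi0 : xi s ≠ 0 := by
    rw [hxi]
    simp [hs0, hs1', hZ]
  have hE0 : Efun x ≠ 0 := fun h => hxi0 <| by
    apply Complex.ext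
    · have := congrArg Complex.re (hE.symm.trans h)
      simpa [hdre] using this
    · simpa using him
  have hlog : deriv Zfun s / Zfun s = deriv xi s / xi s - 1 / s - 1 / (s - 1) := by
    rw [hd, hxi]
    field_simp
    ring
  have hfirst : (1 + Theta x) * (deriv xi s / xi s) = 2 * (deriv xi s / Efun x) := by
    have := hθ hE0
    field_simp
    linear_combination deriv xi s * this
  have hb : ‖deriv xi s / Efun x‖ ≤ 1 := by
    rw [norm_div]
    refine div_le_one_of_le₀ ?_ (norm_nonneg _)
    rw [Complex.norm_def, Complex.norm_def]
    apply Real.sqrt_le_sqrt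
    rw [hE]
    simp only [Complex.normSq_apply, Complex.add_re, Complex.add_im, him, hdre]
    nlinarith [sq_nonneg (xi s).re]
  have hinv : ∀ w : ℂ, 1 / 2 ≤ |w.re| → ‖1 / w‖ ≤ 2 := fun w hw => by
    have h1 : 1 / 2 ≤ ‖w‖ := hw.trans (Complex.abs_re_le_norm w)
    rw [norm_div, norm_one, div_le_iff₀ (by linarith)]
    linarith
  have h1 := hinv s (by rw [hre]; norm_num)
  have h2 := hinv (s - 1) (by rw [Complex.sub_re, hre]; norm_num)
  have hsplit : (1 + Theta x) * (deriv Zfun s / Zfun s) =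
      2 * (deriv xi s / Efun x) - (1 + Theta x) * (1 / s) - (1 + Theta x) * (1 / (s - 1)) := by
    rw [hlog, ← hfirst]
    ring
  rw [hsplit]
  refine (norm_sub_le _ _).trans ?_
  have h3 := norm_sub_le (2 * (deriv xi s / Efun x)) ((1 + Theta x) * (1 / s))
  have h4 : ‖(1 + Theta x) * (1 / s)‖ ≤ 2 * 2 := by
    rw [norm_mul]; gcongr
  have h5 : ‖(1 + Theta x) * (1 / (s - 1))‖ ≤ 2 * 2 := by
    rw [norm_mul]; gcongr
  have h6 : ‖2 * (deriv xi s / Efun x)‖ ≤ 2 := by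
    rw [norm_mul, RCLike.norm_ofNat]; linarith
  linarith

end CriticalLine

section Digamma

theorem summable_add_quarter_rpow {p : ℝ} (hp : 1 < p) :
    Summable fun n : ℕ => 1 / ((n : ℝ) + 1 / 4) ^ p := by
  refine ((Real.summable_one_div_nat_add_rpow (1 / 4) p).2 hp).congr fun n => ?_
  rw [abs_of_nonneg (by positivity)]

/-- Terms of a normalized Weierstrass series for `log Γ` based at `1 / 4`. -/
def logGammaTerm (n : ℕ) (s : ℂ) : ℂ :=
  (s - 1 / 4) / (n + 1 / 4) - (Complex.log (s + n) - Complex.log (1 / 4 + n))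

theorem natCast_add_quarter_ne_zero (n : ℕ) : (n + 1 / 4 : ℂ) ≠ 0 := fun h => by
  have := congrArg Complex.re h
  norm_num at this
  have : (0 : ℝ) ≤ n := n.cast_nonneg
  linarith

theorem hasDerivAt_logGammaTerm (n : ℕ) {s : ℂ} (hs : 0 < s.re) :
    HasDerivAt (logGammaTerm n) (1 / (n + 1 / 4) - 1 / (s + n)) s := by
  have hslit : s + n ∈ Complex.slitPlane := Or.inl (by simp; positivity)
  exact (((hasDerivAt_id s).sub_const _).div_const _).sub
    ((((hasDerivAt_id s).add_const _).clog hslit).sub_const _)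

theorem norm_deriv_logGammaTerm_le (n : ℕ) {s : ℂ} (hs : 1 / 8 < s.re) :
    ‖(1 / (n + 1 / 4) - 1 / (s + n) : ℂ)‖ ≤
      2 * (‖s‖ + 1) * (1 / ((n : ℝ) + 1 / 4) ^ (2 : ℝ)) := by
  have hq := natCast_add_quarter_ne_zero n
  have hlow : ((n : ℝ) + 1 / 4) / 2 ≤ ‖s + n‖ := by
    refine le_trans ?_ (Complex.re_le_norm _)
    have : (0 : ℝ) ≤ n := n.cast_nonneg
    simp
    linarith
  have hpos : (0 : ℝ) < (n : ℝ) + 1 / 4 := by positivity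
  have hsn : s + n ≠ 0 := norm_pos_iff.1 (by linarith)
  have heq : (1 / (n + 1 / 4) - 1 / (s + n) : ℂ) = (s - 1 / 4) / ((n + 1 / 4) * (s + n)) := by
    rw [div_sub_div _ _ hq hsn]
    congr 1
    ring
  have hnq : ‖(n + 1 / 4 : ℂ)‖ = (n : ℝ) + 1 / 4 := by
    rw [show (n + 1 / 4 : ℂ) = ((n + 1 / 4 : ℝ) : ℂ) by push_cast; ring, Complex.norm_real,
      Real.norm_of_nonneg hpos.le]
  have hnum : ‖s - 1 / 4‖ ≤ ‖s‖ + 1 := by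
    refine (norm_sub_le _ _).trans ?_
    gcongr
    norm_num
  rw [heq, norm_div, norm_mul, hnq, Real.rpow_two]
  calc ‖s - 1 / 4‖ / (((n : ℝ) + 1 / 4) * ‖s + n‖)
      ≤ (‖s‖ + 1) / (((n : ℝ) + 1 / 4) * (((n : ℝ) + 1 / 4) / 2)) := by gcongr
    _ = 2 * (‖s‖ + 1) * (1 / ((n : ℝ) + 1 / 4) ^ 2) := by field_simp

theorem logGammaTerm_series {s : ℂ} (hs : 1 / 8 < s.re) :
    Summable (fun n => logGammaTerm n s) ∧
      HasDerivAt (fun w => ∑' n, logGammaTerm n w) (∑' n : ℕ, (1 / (n + 1 / 4) - 1 / (s + n))) s := by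
  let U : Set ℂ := {w | 1 / 8 < w.re} ∩ Metric.ball 0 (‖s‖ + 1)
  have hU : IsOpen U :=
    (isOpen_lt continuous_const Complex.continuous_re).inter Metric.isOpen_ball
  have hpre : IsPreconnected U :=
    ((convex_halfSpace_re_gt _).inter (convex_ball _ _)).isPreconnected
  have hsU : s ∈ U := ⟨hs, by simp⟩
  have hqU : (1 / 4 : ℂ) ∈ U := ⟨by norm_num, by simp; linarith [norm_nonneg s]⟩
  have hsum : Summable fun n : ℕ =>
      2 * (‖s‖ + 1 + 1) * (1 / ((n : ℝ) + 1 / 4) ^ (2 : ℝ)) :=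
    (summable_add_quarter_rpow (by norm_num)).mul_left _
  have hd : ∀ (n : ℕ) (w : ℂ), w ∈ U →
      HasDerivAt (logGammaTerm n) (1 / (n + 1 / 4) - 1 / (w + n)) w := fun n w hw =>
    hasDerivAt_logGammaTerm n (by have := hw.1; simp at this; linarith)
  have hb : ∀ (n : ℕ) (w : ℂ), w ∈ U → ‖(1 / (n + 1 / 4) - 1 / (w + n) : ℂ)‖ ≤
      2 * (‖s‖ + 1 + 1) * (1 / ((n : ℝ) + 1 / 4) ^ (2 : ℝ)) := fun n w hw => by
    refine (norm_deriv_logGammaTerm_le n hw.1).trans ?_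
    have : ‖w‖ < ‖s‖ + 1 := by simpa using hw.2
    gcongr
  have h0 : Summable fun n => logGammaTerm n (1 / 4) := by simp [logGammaTerm]
  exact ⟨summable_of_summable_hasDerivAt_of_isPreconnected hsum hU hpre hd hb hqU h0 hsU,
    hasDerivAt_tsum_of_isPreconnected hsum hU hpre hd hb hqU h0 hsU⟩

theorem exp_sum_logGammaTerm {s : ℂ} (hs : 0 < s.re) {N : ℕ} (hN : N ≠ 0) :
    Complex.exp (∑ n ∈ Finset.range (N + 1), logGammaTerm n s) * Complex.GammaSeq (1 / 4) N =
      Complex.GammaSeq s N * Complex.exp ((s - 1 / 4) *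
        ((∑ n ∈ Finset.range (N + 1), 1 / ((n : ℝ) + 1 / 4) - Real.log N : ℝ) : ℂ)) := by
  have hne : ∀ w : ℂ, 0 < w.re → ∀ n : ℕ, w + n ≠ 0 := fun w hw n h => by
    have := congrArg Complex.re h
    simp at this
    have : (0 : ℝ) ≤ n := n.cast_nonneg
    linarith
  have hs' := hne s hs
  have hq := hne (1 / 4) (by norm_num)
  have hN' : (N : ℂ) ≠ 0 := by exact_mod_cast hN
  have hterm : ∀ n : ℕ, Complex.exp (logGammaTerm n s) =
      Complex.exp ((s - 1 / 4) * (1 / (n + 1 / 4))) * ((1 / 4 + n) / (s + n)) := fun n => by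
    rw [logGammaTerm, Complex.exp_sub, Complex.exp_sub, Complex.exp_log (hs' n),
      Complex.exp_log (hq n), mul_one_div]
    have := hs' n
    have := hq n
    field_simp
  have hp1 : (∏ j ∈ Finset.range (N + 1), (s + j)) ≠ 0 := Finset.prod_ne_zero_iff.2 fun n _ => hs' n
  have hp2 : (∏ j ∈ Finset.range (N + 1), ((1 / 4 : ℂ) + j)) ≠ 0 :=
    Finset.prod_ne_zero_iff.2 fun n _ => hq n
  have hexp : Complex.exp ((s - 1 / 4) *
        ((∑ n ∈ Finset.range (N + 1), 1 / ((n : ℝ) + 1 / 4) - Real.log N : ℝ) : ℂ)) =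
      Complex.exp (∑ n ∈ Finset.range (N + 1), (s - 1 / 4) * (1 / ((n : ℂ) + 1 / 4))) *
        ((N : ℂ) ^ (1 / 4 : ℂ) / (N : ℂ) ^ s) := by
    rw [Complex.cpow_def_of_ne_zero hN', Complex.cpow_def_of_ne_zero hN', ← Complex.exp_sub,
      ← Complex.exp_add, ← Finset.mul_sum]
    congr 1
    push_cast [Complex.natCast_log]
    ring
  have hcp : (N : ℂ) ^ s ≠ 0 := by simp [Complex.cpow_eq_zero_iff, hN']
  rw [Complex.exp_sum, Finset.prod_congr rfl fun n _ => hterm n, Finset.prod_mul_distrib,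
    Finset.prod_div_distrib, ← Complex.exp_sum, hexp, Complex.GammaSeq, Complex.GammaSeq]
  generalize (∏ j ∈ Finset.range (N + 1), ((1 / 4 : ℂ) + j)) = P at *
  field_simp

theorem exists_exp_tsum_logGammaTerm : ∃ κ : ℝ, ∀ s : ℂ, 1 / 8 < s.re →
    Complex.exp (∑' n, logGammaTerm n s) * Complex.Gamma (1 / 4) =
      Complex.Gamma s * Complex.exp ((s - 1 / 4) * κ) := by
  let H : ℕ → ℝ := fun N => ∑ n ∈ Finset.range (N + 1), 1 / ((n : ℝ) + 1 / 4) - Real.log N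
  have hL : ∀ s : ℂ, 1 / 8 < s.re → Tendsto (fun N =>
      Complex.exp (∑ n ∈ Finset.range (N + 1), logGammaTerm n s) * Complex.GammaSeq (1 / 4) N)
      atTop (nhds (Complex.exp (∑' n, logGammaTerm n s) * Complex.Gamma (1 / 4))) := fun s hs =>
    (((Complex.continuous_exp.tendsto _).comp (logGammaTerm_series hs).1.hasSum.tendsto_sum_nat
      ).comp (tendsto_add_atTop_nat 1)).mul (Complex.GammaSeq_tendsto_Gamma _)
  have hG : ∀ s : ℂ, 1 / 8 < s.re → Complex.Gamma s ≠ 0 := fun s hs =>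
    Complex.Gamma_ne_zero_of_re_pos (by linarith)
  have hH : ∃ κ, Tendsto H atTop (nhds κ) := by
    have h54 : (1 / 8 : ℝ) < (5 / 4 : ℂ).re := by norm_num
    have h := ((hL (5 / 4) h54).div (Complex.GammaSeq_tendsto_Gamma (5 / 4)) (hG _ h54)).norm
    have hne : ‖Complex.exp (∑' n, logGammaTerm n (5 / 4)) * Complex.Gamma (1 / 4) /
        Complex.Gamma (5 / 4)‖ ≠ 0 := by
      have := hG (5 / 4) h54
      have := hG (1 / 4) (by norm_num)
      exact norm_ne_zero_iff.2 (div_ne_zero (mul_ne_zero (Complex.exp_ne_zero _) ‹_›) ‹_›)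
    refine ⟨_, (h.log hne).congr' ?_⟩
    filter_upwards [eventually_ne_atTop 0,
      (Complex.GammaSeq_tendsto_Gamma (5 / 4)).eventually_ne (hG _ h54)] with N hN hN'
    simp only [Pi.div_apply]
    rw [exp_sum_logGammaTerm (by norm_num) hN, mul_div_cancel_left₀ _ hN',
      show (5 / 4 - 1 / 4 : ℂ) = 1 by norm_num, one_mul, Complex.norm_exp, Complex.ofReal_re,
      Real.log_exp]
  obtain ⟨κ, hκ⟩ := hH
  refine ⟨κ, fun s hs => tendsto_nhds_unique (hL s hs) ?_⟩
  have hR : Tendsto (fun N => Complex.GammaSeq s N * Complex.exp ((s - 1 / 4) * (H N : ℂ))) atTop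
      (nhds (Complex.Gamma s * Complex.exp ((s - 1 / 4) * κ))) :=
    (Complex.GammaSeq_tendsto_Gamma s).mul ((Complex.continuous_exp.tendsto _).comp
      (((Complex.continuous_ofReal.tendsto _).comp hκ).const_mul _))
  refine hR.congr' ?_
  filter_upwards [eventually_ne_atTop 0] with N hN
  exact (exp_sum_logGammaTerm (by linarith) hN).symm

theorem digamma_sub_digamma_quarter {s : ℂ} (hs : 1 / 8 < s.re) :
    _root_.digamma s - _root_.digamma (1 / 4) = ∑' n : ℕ, (1 / (n + 1 / 4) - 1 / (s + n)) := by
  obtain ⟨κ, hκ⟩ := exists_exp_tsum_logGammaTerm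
  have key : ∀ s : ℂ, 1 / 8 < s.re →
      _root_.digamma s = ∑' n : ℕ, (1 / (n + 1 / 4) - 1 / (s + n)) - κ := fun s hs => by
    have hΓ : Complex.Gamma s ≠ 0 := Complex.Gamma_ne_zero_of_re_pos (by linarith)
    have heq : ∀ w : ℂ, 1 / 8 < w.re → Complex.Gamma w = Complex.Gamma (1 / 4) *
        Complex.exp (∑' n, logGammaTerm n w - (w - 1 / 4) * κ) := fun w hw => by
      have hE := Complex.exp_ne_zero ((w - 1 / 4) * κ)
      rw [Complex.exp_sub, eq_comm, mul_div_assoc', div_eq_iff hE, ← hκ w hw, mul_comm]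
    have hd := (((logGammaTerm_series hs).2.sub
      (((hasDerivAt_id s).sub_const (1 / 4)).mul_const (κ : ℂ))).cexp).const_mul
        (Complex.Gamma (1 / 4))
    have hd' : HasDerivAt Complex.Gamma
        (Complex.Gamma s * (∑' n : ℕ, (1 / (n + 1 / 4) - 1 / (s + n)) - κ)) s := by
      refine (hd.congr_of_eventuallyEq ?_).congr_deriv ?_
      · filter_upwards [(isOpen_lt continuous_const Complex.continuous_re).mem_nhds hs] with w hw
        exact heq w hw
      · rw [heq s hs]
        simp [mul_assoc]
    rw [_root_.digamma, hd'.deriv, mul_div_cancel_left₀ _ hΓ]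
  rw [key s hs, key (1 / 4) (by norm_num)]
  have : ∀ n : ℕ, (1 / (n + 1 / 4) - 1 / (1 / 4 + n) : ℂ) = 0 := fun n => by
    rw [add_comm, sub_self]
  simp only [this, tsum_zero]
  ring

/-- The series `∑ r ^ n / ((n + 1/4) (n + 1/4 + ix/2))`. -/
def lerchQuotient (r x : ℝ) : ℂ := ∑' n : ℕ, (r : ℂ) ^ n / ((n + 1 / 4) * (n + 1 / 4 + I * x / 2))

theorem add_quarter_add_ne_zero (n : ℕ) (x : ℝ) : (n + 1 / 4 + I * x / 2 : ℂ) ≠ 0 := fun h => by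
  have := congrArg Complex.re h
  norm_num at this
  have : (0 : ℝ) ≤ n := n.cast_nonneg
  linarith

theorem norm_lerchQuotient_le : ∃ K : ℝ, 0 ≤ K ∧ ∀ r x : ℝ, |r| ≤ 1 →
    ‖lerchQuotient r x‖ ≤ K * (1 + |x|) ^ (-(3 / 4) : ℝ) := by
  have hS := summable_add_quarter_rpow (p := 5 / 4) (by norm_num)
  refine ⟨8 ^ (3 / 4 : ℝ) * ∑' n : ℕ, 1 / ((n : ℝ) + 1 / 4) ^ (5 / 4 : ℝ),
    mul_nonneg (by positivity) (tsum_nonneg fun n => by positivity), fun r x hr => ?_⟩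
  have hb : ∀ n : ℕ, ‖(r : ℂ) ^ n / ((n + 1 / 4) * (n + 1 / 4 + I * x / 2))‖ ≤
      8 ^ (3 / 4 : ℝ) * (1 + |x|) ^ (-(3 / 4) : ℝ) * (1 / ((n : ℝ) + 1 / 4) ^ (5 / 4 : ℝ)) := by
    intro n
    set a : ℝ := (n : ℝ) + 1 / 4 with ha
    have ha4 : 1 / 4 ≤ a := by
      have : (0 : ℝ) ≤ n := n.cast_nonneg
      linarith
    have hapos : 0 < a := by linarith
    set b : ℝ := (1 + |x|) / 8 with hb
    have hbpos : 0 < b := by positivity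
    set c : ℂ := n + 1 / 4 + I * x / 2 with hc
    have hre : c.re = a := by simp [hc, ha]
    have him : c.im = x / 2 := by simp [hc]
    have hca : a ≤ ‖c‖ := hre ▸ Complex.re_le_norm c
    have hcb : b ≤ ‖c‖ := by
      have h := Complex.abs_im_le_norm c
      rw [him, abs_div, abs_of_pos (zero_lt_two (α := ℝ))] at h
      rw [hb]
      linarith
    have hcl : a ^ (1 / 4 : ℝ) * b ^ (3 / 4 : ℝ) ≤ ‖c‖ := by
      calc a ^ (1 / 4 : ℝ) * b ^ (3 / 4 : ℝ)
          ≤ ‖c‖ ^ (1 / 4 : ℝ) * ‖c‖ ^ (3 / 4 : ℝ) := by gcongr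
        _ = ‖c‖ := by
          rw [← Real.rpow_add (by linarith)]
          norm_num
    have hna : ‖(n + 1 / 4 : ℂ)‖ = a := by
      rw [show (n + 1 / 4 : ℂ) = (a : ℂ) by simp [ha], Complex.norm_real,
        Real.norm_of_nonneg hapos.le]
    have hrn : ‖(r : ℂ) ^ n‖ ≤ 1 := by
      rw [norm_pow, Complex.norm_real]
      exact pow_le_one₀ (norm_nonneg _) hr
    rw [norm_div, norm_mul, hna]
    calc ‖(r : ℂ) ^ n‖ / (a * ‖c‖) ≤ 1 / (a * (a ^ (1 / 4 : ℝ) * b ^ (3 / 4 : ℝ))) := by gcongr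
      _ = 8 ^ (3 / 4 : ℝ) * (1 + |x|) ^ (-(3 / 4) : ℝ) * (1 / a ^ (5 / 4 : ℝ)) := by
        rw [show (5 / 4 : ℝ) = 1 + 1 / 4 by norm_num, Real.rpow_add hapos, Real.rpow_one, hb,
          Real.div_rpow (by positivity) (by norm_num), Real.rpow_neg (by positivity)]
        field_simp
  refine (tsum_of_norm_bounded (hS.hasSum.mul_left _) hb).trans (le_of_eq ?_)
  ring

theorem digamma_eq_lerchQuotient (x : ℝ) : _root_.digamma (1 / 4 + I * x / 2) =
    _root_.digamma (1 / 4) + I * x / 2 * lerchQuotient 1 x := by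
  rw [← sub_eq_iff_eq_add', digamma_sub_digamma_quarter (by norm_num), lerchQuotient,
    ← tsum_mul_left]
  refine tsum_congr fun n => ?_
  have h1 := natCast_add_quarter_ne_zero n
  have h2 := add_quarter_add_ne_zero n x
  rw [show (1 / 4 + I * x / 2 + n : ℂ) = n + 1 / 4 + I * x / 2 by ring, Complex.ofReal_one, one_pow,
    div_sub_div _ _ h1 h2, mul_one_div]
  congr 1
  ring

theorem PhiC_sub_PhiC {r : ℝ} (hr0 : 0 ≤ r) (hr : r < 1) (x : ℝ) :
    PhiC r 1 (1 / 4) - PhiC r 1 ((1 / 2 + I * x) / 2) = I * x / 2 * lerchQuotient r x := by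
  have hsum : ∀ y : ℝ, Summable fun n : ℕ => (r : ℂ) ^ n / (n + 1 / 4 + I * y / 2) := fun y => by
    refine Summable.of_norm_bounded ((summable_geometric_of_lt_one hr0 hr).mul_left 4) fun n => ?_
    have h : (1 / 4 : ℝ) ≤ ‖(n + 1 / 4 + I * y / 2 : ℂ)‖ := by
      refine le_trans ?_ (Complex.re_le_norm _)
      simp
    rw [norm_div, norm_pow, Complex.norm_real, Real.norm_of_nonneg hr0,
      div_le_iff₀ (by linarith)]
    nlinarith [pow_nonneg hr0 n]
  have h0 := hsum 0
  simp only [Complex.ofReal_zero, mul_zero, zero_div, add_zero] at h0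
  simp only [PhiC, Complex.cpow_one]
  rw [show ((1 / 2 + I * x) / 2 : ℂ) = 1 / 4 + I * x / 2 by ring]
  simp only [← add_assoc]
  rw [← h0.tsum_sub (hsum x), lerchQuotient, ← tsum_mul_left]
  refine tsum_congr fun n => ?_
  have h1 := natCast_add_quarter_ne_zero n
  have h2 := add_quarter_add_ne_zero n x
  rw [div_sub_div _ _ h1 h2, mul_div_assoc']
  congr 1
  ring

end Digamma

section Bound

theorem one_div_one_add_abs_le (x : ℝ) : 1 / (1 + |x|) ≤ (1 + |x|) ^ (-(3 / 4) : ℝ) := by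
  have h1 : 1 ≤ 1 + |x| := by linarith [abs_nonneg x]
  rw [one_div, ← Real.rpow_neg_one]
  exact Real.rpow_le_rpow_of_exponent_le h1 (by norm_num)

theorem norm_exp_sub_one_le_two (y : ℝ) : ‖Complex.exp (I * y) - 1‖ ≤ 2 := by
  refine (norm_sub_le _ _).trans ?_
  rw [mul_comm, Complex.norm_exp_ofReal_mul_I]
  norm_num

theorem norm_exp_sub_one_div_le {T u x : ℝ} (hu : |u| ≤ T) (hx : x ≠ 0) :
    ‖(Complex.exp (I * x * u) - 1) / (I * x)‖ ≤ (T + 2) * (1 + |x|) ^ (-(3 / 4) : ℝ) := by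
  have hT : 0 ≤ T := (abs_nonneg u).trans hu
  have hx' : 0 < |x| := abs_pos.2 hx
  refine le_trans ?_ (mul_le_mul_of_nonneg_left (one_div_one_add_abs_le x) (by linarith))
  have he : (I * x * u : ℂ) = I * ((x * u : ℝ) : ℂ) := by push_cast; ring
  have h1 := norm_exp_sub_one_le_two (x * u)
  have h2 : ‖Complex.exp (I * ((x * u : ℝ) : ℂ)) - 1‖ ≤ |x| * T := by
    refine Real.norm_exp_I_mul_ofReal_sub_one_le.trans ?_
    rw [Real.norm_eq_abs, abs_mul]
    gcongr
  rw [he, norm_div, norm_mul, Complex.norm_I, one_mul, Complex.norm_real, Real.norm_eq_abs,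
    mul_one_div, div_le_div_iff₀ hx' (by positivity)]
  nlinarith

theorem norm_div_le_of_re_eq_one {a b : ℂ} {M x : ℝ} (ha : ‖a‖ ≤ M) (hre : b.re = 1)
    (him : |b.im| = 2 * |x|) : ‖a / b‖ ≤ M * (2 * (1 + |x|) ^ (-(3 / 4) : ℝ)) := by
  have h1 := Complex.abs_re_le_norm b
  have h2 := Complex.abs_im_le_norm b
  rw [hre, abs_one] at h1
  rw [him] at h2
  have hM : 0 ≤ M := (norm_nonneg a).trans ha
  have hb : (1 + |x|) / 2 ≤ ‖b‖ := by linarith [abs_nonneg x]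
  calc ‖a / b‖ = ‖a‖ / ‖b‖ := norm_div _ _
    _ ≤ M / ((1 + |x|) / 2) := by gcongr
    _ = M * (2 * (1 / (1 + |x|))) := by field_simp
    _ ≤ M * (2 * (1 + |x|) ^ (-(3 / 4) : ℝ)) := by
      have := one_div_one_add_abs_le x
      gcongr

theorem norm_vonMangoldt_sum_le {T t x : ℝ} (ht : 0 ≤ t) (htT : t ≤ T) (hx : x ≠ 0) :
    ‖∑ n ∈ Finset.Icc 1 ⌊Real.exp t⌋₊, ((vM n / Real.sqrt n : ℝ) : ℂ) *
        ((Complex.exp (I * x * ((t : ℝ) - Real.log n)) - 1) / (I * x))‖ ≤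
      (∑ n ∈ Finset.Icc 1 ⌊Real.exp T⌋₊, |vM n / Real.sqrt n|) * (T + 2) *
        (1 + |x|) ^ (-(3 / 4) : ℝ) := by
  have hT : 0 ≤ T := ht.trans htT
  refine (norm_sum_le _ _).trans ?_
  rw [mul_assoc, Finset.sum_mul]
  have hsub : Finset.Icc 1 ⌊Real.exp t⌋₊ ⊆ Finset.Icc 1 ⌊Real.exp T⌋₊ :=
    Finset.Icc_subset_Icc_right (Nat.floor_mono (Real.exp_le_exp.2 htT))
  refine le_trans (Finset.sum_le_sum fun n hn => ?_)
    (Finset.sum_le_sum_of_subset_of_nonneg hsub fun n _ _ => by positivity)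
  obtain ⟨hn1, hn2⟩ := Finset.mem_Icc.1 hn
  have hn1' : (1 : ℝ) ≤ n := by exact_mod_cast hn1
  have hlog0 : 0 ≤ Real.log n := Real.log_nonneg hn1'
  have hlog : Real.log n ≤ t := by
    rw [Real.log_le_iff_le_exp (by linarith)]
    exact (Nat.le_floor_iff (Real.exp_pos t).le).1 hn2
  have h := norm_exp_sub_one_div_le (T := T) (u := t - Real.log n) (x := x)
    (by rw [abs_of_nonneg (by linarith)]; linarith) hx
  rw [norm_mul, Complex.norm_real, Real.norm_eq_abs]
  push_cast at h ⊢
  gcongr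

theorem Pfrak_eq {t x : ℝ} (ht : 0 < t) (hx : x ≠ 0) :
    Pfrak t x =
      (4 * ((Real.exp (t / 2) : ℂ) - 1) / (1 - 2 * I * x)
        + 4 * ((Real.exp (-t / 2) : ℂ) - 1) / (1 + 2 * I * x)
        - ∑ n ∈ Finset.Icc 1 ⌊Real.exp t⌋₊, ((vM n / Real.sqrt n : ℝ) : ℂ) *
            ((Complex.exp (I * x * ((t : ℝ) - Real.log n)) - 1) / (I * x))
        + (Complex.exp (I * x * t) - 1) / (I * x) *
            ((1 / 2) * (_root_.digamma (1 / 4) - (Real.log π : ℂ)))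
        + (Complex.exp (I * x * t) - 1) / 4 * lerchQuotient 1 x
        + 1 / 4 * lerchQuotient 1 x
        - 1 / 4 * (Real.exp (-t / 2) : ℂ) * lerchQuotient (Real.exp (-2 * t)) x)
      + (Complex.exp (I * x * t) - 1) / (I * x) *
          (deriv Zfun (1 / 2 - I * x) / Zfun (1 / 2 - I * x)) := by
  have hx' : (x : ℂ) ≠ 0 := by exact_mod_cast hx
  have hr : Real.exp (-2 * t) < 1 := by
    rw [← Real.exp_zero]
    exact Real.exp_lt_exp.2 (by linarith)
  have hI := Complex.I_ne_zero
  rw [Pfrak, PhiC_sub_PhiC (Real.exp_pos _).le hr, digamma_eq_lerchQuotient,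
    show I * (t : ℂ) * x = I * x * t by ring]
  generalize (∑ n ∈ Finset.Icc 1 ⌊Real.exp t⌋₊, ((vM n / Real.sqrt n : ℝ) : ℂ) *
    ((Complex.exp (I * x * ((t : ℝ) - Real.log n)) - 1) / (I * x))) = S
  generalize deriv Zfun (1 / 2 - I * x) / Zfun (1 / 2 - I * x) = D
  generalize 4 * ((Real.exp (t / 2) : ℂ) - 1) / (1 - 2 * I * x) = A
  generalize 4 * ((Real.exp (-t / 2) : ℂ) - 1) / (1 + 2 * I * x) = B
  field_simp
  ring

theorem norm_Sfrak_le (T : ℝ) : ∃ C : ℝ, 0 ≤ C ∧ ∀ t x : ℝ, t ≠ 0 → |t| ≤ T → x ≠ 0 →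
    ‖Sfrak t x‖ ≤ C * (1 + |x|) ^ (-(3 / 4) : ℝ) := by
  obtain ⟨K, hK, hL⟩ := norm_lerchQuotient_le
  let B : ℝ := 4 * Real.exp (T / 2) * 2 + 4 * 2
    + (∑ n ∈ Finset.Icc 1 ⌊Real.exp T⌋₊, |vM n / Real.sqrt n|) * (T + 2)
    + (T + 2) * ‖(1 / 2) * (_root_.digamma (1 / 4) - (Real.log π : ℂ))‖ + K + K + K
  let N : ℝ := ‖I / (2 * (Real.sqrt π : ℂ))‖
  have main : ∀ t x : ℝ, t ≠ 0 → |t| ≤ T → x ≠ 0 →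
      ‖Sfrak t x‖ ≤ N * (2 * B + (T + 2) * 10) * (1 + |x|) ^ (-(3 / 4) : ℝ) := by
    intro t x ht htT hx
    have hT : 0 ≤ T := (abs_nonneg t).trans htT
    have hΘ := norm_one_add_Theta_ofReal_le x
    have hZ := norm_one_add_Theta_mul_logDeriv_le x
    have hu0 : 0 < |t| := abs_pos.2 ht
    rw [Sfrak, Pfrak_eq hu0 hx]
    generalize |t| = u at *
    have hW : 0 ≤ (1 + |x|) ^ (-(3 / 4) : ℝ) := by positivity
    have hL1 := hL 1 x (by simp)
    have hLr := hL (Real.exp (-2 * u)) x (by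
      rw [abs_of_pos (Real.exp_pos _)]
      exact Real.exp_le_one_iff.2 (by linarith))
    have hS := norm_vonMangoldt_sum_le hu0.le htT hx
    have hA := norm_exp_sub_one_div_le (T := T) (u := u) (by rwa [abs_of_pos hu0]) hx
    have hE : ‖Complex.exp (I * x * u) - 1‖ ≤ 2 := by
      simpa [mul_assoc] using norm_exp_sub_one_le_two (x * u)
    have he : Real.exp (-u / 2) ≤ 1 := Real.exp_le_one_iff.2 (by linarith)
    have he0 := Real.exp_pos (-u / 2)
    have h1 : ‖4 * ((Real.exp (u / 2) : ℂ) - 1) / (1 - 2 * I * x)‖ ≤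
        4 * Real.exp (T / 2) * (2 * (1 + |x|) ^ (-(3 / 4) : ℝ)) := by
      refine norm_div_le_of_re_eq_one ?_ (by simp) (by simp [abs_mul])
      have : 1 ≤ Real.exp (u / 2) := Real.one_le_exp (by linarith)
      rw [norm_mul, RCLike.norm_ofNat, ← Complex.ofReal_one, ← Complex.ofReal_sub,
        Complex.norm_real, Real.norm_of_nonneg (by linarith)]
      have : Real.exp (u / 2) ≤ Real.exp (T / 2) := Real.exp_le_exp.2 (by linarith)
      linarith
    have h2 : ‖4 * ((Real.exp (-u / 2) : ℂ) - 1) / (1 + 2 * I * x)‖ ≤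
        4 * (2 * (1 + |x|) ^ (-(3 / 4) : ℝ)) := by
      refine norm_div_le_of_re_eq_one ?_ (by simp) (by simp [abs_mul])
      rw [norm_mul, RCLike.norm_ofNat, ← Complex.ofReal_one, ← Complex.ofReal_sub,
        Complex.norm_real, Real.norm_of_nonpos (by linarith)]
      linarith
    generalize 4 * ((Real.exp (u / 2) : ℂ) - 1) / (1 - 2 * I * x) = P₁ at *
    generalize 4 * ((Real.exp (-u / 2) : ℂ) - 1) / (1 + 2 * I * x) = P₂ at *
    generalize (∑ n ∈ Finset.Icc 1 ⌊Real.exp u⌋₊, ((vM n / Real.sqrt n : ℝ) : ℂ) *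
      ((Complex.exp (I * x * ((u : ℝ) - Real.log n)) - 1) / (I * x))) = P₃ at *
    generalize hV : (Complex.exp (I * x * u) - 1) / (I * x) = A at *
    generalize deriv Zfun (1 / 2 - I * x) / Zfun (1 / 2 - I * x) = D at *
    have h4 : ‖A * ((1 / 2) * (_root_.digamma (1 / 4) - (Real.log π : ℂ)))‖ ≤
        (T + 2) * (1 + |x|) ^ (-(3 / 4) : ℝ) *
          ‖(1 / 2) * (_root_.digamma (1 / 4) - (Real.log π : ℂ))‖ := by
      rw [norm_mul]
      gcongr
    have h5 : ‖(Complex.exp (I * x * u) - 1) / 4 * lerchQuotient 1 x‖ ≤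
        K * (1 + |x|) ^ (-(3 / 4) : ℝ) := by
      rw [norm_mul, norm_div, RCLike.norm_ofNat]
      nlinarith [norm_nonneg (lerchQuotient 1 x)]
    have h6 : ‖1 / 4 * lerchQuotient 1 x‖ ≤ K * (1 + |x|) ^ (-(3 / 4) : ℝ) := by
      rw [norm_mul, norm_div, norm_one, RCLike.norm_ofNat]
      linarith [norm_nonneg (lerchQuotient 1 x)]
    have h7 : ‖1 / 4 * (Real.exp (-u / 2) : ℂ) * lerchQuotient (Real.exp (-2 * u)) x‖ ≤
        K * (1 + |x|) ^ (-(3 / 4) : ℝ) := by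
      rw [norm_mul, norm_mul, norm_div, norm_one, RCLike.norm_ofNat, Complex.norm_real,
        Real.norm_of_nonneg he0.le]
      nlinarith [norm_nonneg (lerchQuotient (Real.exp (-2 * u)) x)]
    generalize A * ((1 / 2) * (_root_.digamma (1 / 4) - (Real.log π : ℂ))) = P₄ at *
    generalize (Complex.exp (I * x * u) - 1) / 4 * lerchQuotient 1 x = P₅ at *
    generalize 1 / 4 * lerchQuotient 1 x = P₆ at *
    generalize 1 / 4 * (Real.exp (-u / 2) : ℂ) * lerchQuotient (Real.exp (-2 * u)) x = P₇ at *
    have hR : ‖P₁ + P₂ - P₃ + P₄ + P₅ + P₆ - P₇‖ ≤ B * (1 + |x|) ^ (-(3 / 4) : ℝ) := by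
      have e1 := norm_add_le P₁ P₂
      have e2 := norm_sub_le (P₁ + P₂) P₃
      have e3 := norm_add_le (P₁ + P₂ - P₃) P₄
      have e4 := norm_add_le (P₁ + P₂ - P₃ + P₄) P₅
      have e5 := norm_add_le (P₁ + P₂ - P₃ + P₄ + P₅) P₆
      have e6 := norm_sub_le (P₁ + P₂ - P₃ + P₄ + P₅ + P₆) P₇
      simp only [B]
      linarith
    generalize P₁ + P₂ - P₃ + P₄ + P₅ + P₆ - P₇ = R at *
    have hsplit : I * (1 + Theta x) / (2 * (Real.sqrt π : ℂ)) * (R + A * D) =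
        I / (2 * (Real.sqrt π : ℂ)) * ((1 + Theta x) * R + A * ((1 + Theta x) * D)) := by ring
    rw [hsplit, norm_mul, mul_assoc]
    refine mul_le_mul_of_nonneg_left ((norm_add_le _ _).trans ?_) (norm_nonneg _)
    have f1 : ‖(1 + Theta x) * R‖ ≤ 2 * (B * (1 + |x|) ^ (-(3 / 4) : ℝ)) := by
      rw [norm_mul]
      gcongr
    have f2 : ‖A * ((1 + Theta x) * D)‖ ≤ (T + 2) * (1 + |x|) ^ (-(3 / 4) : ℝ) * 10 := by
      rw [norm_mul]
      gcongr
    linarith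
  refine ⟨|N * (2 * B + (T + 2) * 10)|, abs_nonneg _, fun t x ht htT hx =>
    (main t x ht htT hx).trans ?_⟩
  gcongr
  exact le_abs_self _

theorem memLp_one_add_abs_rpow :
    MemLp (fun x : ℝ => (1 + |x|) ^ (-(3 / 4) : ℝ)) 2 volume := by
  rw [memLp_two_iff_integrable_sq (Measurable.aestronglyMeasurable (by fun_prop))]
  refine (integrable_one_add_norm (E := ℝ) (μ := volume) (r := 3 / 2) (by norm_num)).congr ?_
  refine Eventually.of_forall fun x => ?_
  simp only [Real.norm_eq_abs]
  rw [← Real.rpow_natCast, ← Real.rpow_mul (by positivity)]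
  norm_num

theorem stronglyMeasurable_Phat {φ : ℝ → ℂ} (hφ : Continuous φ) :
    StronglyMeasurable fun x : ℝ => Phat φ x := by
  have h : Measurable fun p : ℝ × ℝ => Sfrak p.2 p.1 * φ p.2 :=
    (measurable_Sfrak.comp (f := fun p : ℝ × ℝ => ((p.1 : ℂ), p.2)) (by fun_prop)).mul
      (hφ.measurable.comp measurable_snd)
  exact h.stronglyMeasurable.integral_prod_right'

end Bound

/-- For every smooth compactly supported `φ : ℝ → ℂ`, the function
`𝒫̂_φ(z) = ∫_ℝ 𝔖_t(z) φ(t) dt` restricted to `ℝ` belongs to `L²(ℝ)`. -/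
theorem statement4 (φ : ℝ → ℂ) (hφ : ContDiff ℝ (⊤ : ℕ∞) φ) (hc : HasCompactSupport φ) :
    MemLp (fun x : ℝ => Phat φ (x : ℂ)) 2 volume := by
  obtain ⟨T, hT⟩ := hc.isBounded.exists_norm_le
  obtain ⟨C, hC, hS⟩ := norm_Sfrak_le T
  have hφi : Integrable (fun t => ‖φ t‖) := (hφ.continuous.integrable_of_hasCompactSupport hc).norm
  refine (memLp_one_add_abs_rpow.const_mul (C * ∫ t, ‖φ t‖)).of_le
    (stronglyMeasurable_Phat hφ.continuous).aestronglyMeasurable ?_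
  filter_upwards [Measure.ae_ne volume 0] with x hx
  have hW : 0 ≤ (1 + |x|) ^ (-(3 / 4) : ℝ) := by positivity
  rw [Real.norm_of_nonneg (mul_nonneg (mul_nonneg hC (by positivity)) hW), mul_right_comm,
    ← integral_const_mul]
  refine norm_integral_le_of_norm_le (hφi.const_mul _) ?_
  filter_upwards [Measure.ae_ne volume 0] with t ht
  by_cases h0 : φ t = 0
  · simp [h0]
  · rw [norm_mul]
    gcongr
    exact hS t x ht (hT t (subset_tsupport φ h0)) hx
end
end

section
/- Let t > 0 with t ≠ log n for every positive integer n. Then lim_{y→+∞} [ y·𝔓_t(iy) - (1/2)(Γ'/Γ)(1/4 + y/2) + (1/2) log π ] = -g'(t), where g'(t) = -2(e^{t/2} - e^{-t/2}) + ∑_{n ≤ e^t} Λ(n)/√n - (1/2)[(Γ'/Γ)(1/4) - log π] - (1/2) e^{-t/2} Φ(e^{-2t},1,1/4) is the derivative of g at t. This holds unconditionally, independent of the truth of the Riemann hypothesis. -/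
open MeasureTheory Real Complex Filter Set

noncomputable section

/-- The derivative of `g` at `t > 0`, `t ≠ log n`. -/
def gderiv (t : ℝ) : ℝ :=
  -2 * (Real.exp (t / 2) - Real.exp (-t / 2))
    + ∑ n ∈ Finset.Icc 1 ⌊Real.exp t⌋₊, vM n / Real.sqrt n
    - (1 / 2) * (digammaR (1 / 4) - Real.log π)
    - (1 / 2) * Real.exp (-t / 2) * PhiR (Real.exp (-2 * t)) 1 (1 / 4)

theorem digamma_eq_digamma_add_nat_sub_sum {s : ℂ} (hs : ∀ m : ℕ, s ≠ -m) (N : ℕ) :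
    _root_.digamma s = _root_.digamma (s + N) - ∑ j ∈ Finset.range N, 1 / (s + j) := by
  induction N with
  | zero => simp
  | succ N ih =>
    have h := Complex.digamma_apply_add_one (s + N) fun m hm => hs (N + m) (by
      push_cast
      linear_combination hm)
    change _root_.digamma (s + N + 1) = _root_.digamma (s + N) + (s + N)⁻¹ at h
    rw [Finset.sum_range_succ, ih, Nat.cast_succ, ← add_assoc, h]
    ring

theorem exists_norm_digamma_le_on_Icc :
    ∃ C : ℝ, 0 ≤ C ∧ ∀ x ∈ Icc (1 / 2 : ℝ) 2, ‖_root_.digamma (x : ℂ)‖ ≤ C := by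
  have hopen : IsOpen {s : ℂ | 0 < s.re} := isOpen_lt continuous_const Complex.continuous_re
  have hne (s : ℂ) (hs : 0 < s.re) (m : ℕ) : s ≠ -m := by
    rintro rfl
    have : (0 : ℝ) ≤ m := m.cast_nonneg
    simp at hs
    linarith
  have hdiff : DifferentiableOn ℂ Complex.Gamma {s : ℂ | 0 < s.re} := fun s hs =>
    (Complex.differentiableAt_Gamma s (hne s hs)).differentiableWithinAt
  have hcont : ContinuousOn _root_.digamma {s : ℂ | 0 < s.re} :=
    (hdiff.deriv hopen).continuousOn.div hdiff.continuousOn fun s hs =>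
      Complex.Gamma_ne_zero_of_re_pos hs
  have hcont' : ContinuousOn (fun x : ℝ => _root_.digamma (x : ℂ)) (Icc (1 / 2) 2) :=
    hcont.comp Complex.continuous_ofReal.continuousOn fun x hx => by
      simp only [mem_ofPred_eq, Complex.ofReal_re]
      linarith [hx.1]
  obtain ⟨C, hC⟩ := isCompact_Icc.exists_bound_of_continuousOn hcont'
  exact ⟨C, (norm_nonneg _).trans (hC 1 (by norm_num)), hC⟩

theorem exists_norm_digamma_le_add :
    ∃ C : ℝ, ∀ x : ℝ, 1 ≤ x → ‖_root_.digamma (x : ℂ)‖ ≤ C + x := by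
  obtain ⟨C, -, hC⟩ := exists_norm_digamma_le_on_Icc
  refine ⟨C, fun x hx => ?_⟩
  obtain ⟨N, hN⟩ : ∃ N : ℕ, ⌊x⌋₊ = N + 1 :=
    Nat.exists_eq_add_of_le' (Nat.one_le_floor_iff _ |>.2 hx)
  have h1 := Nat.floor_le (zero_le_one.trans hx)
  have h2 := Nat.lt_floor_add_one x
  rw [hN] at h1 h2
  push_cast at h1 h2
  have hrec := digamma_eq_digamma_add_nat_sub_sum (s := ((x - N : ℝ) : ℂ)) (fun m hm => by
    have h3 : x - N = -m := by exact_mod_cast hm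
    have : (0 : ℝ) ≤ m := m.cast_nonneg
    linarith) N
  have hx' : ((x - N : ℝ) : ℂ) + N = x := by push_cast; ring
  rw [hx'] at hrec
  have hsum : ‖∑ j ∈ Finset.range N, 1 / (((x - N : ℝ) : ℂ) + j)‖ ≤ N := by
    refine (norm_sum_le_of_le (f := fun j : ℕ => 1 / (((x - N : ℝ) : ℂ) + j)) _
      (n := fun _ => (1 : ℝ)) fun j _ => ?_).trans (by simp)
    have hj : (0 : ℝ) ≤ j := j.cast_nonneg
    rw [← Complex.ofReal_natCast j, ← Complex.ofReal_add, norm_div, norm_one,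
      Complex.norm_real, Real.norm_of_nonneg (by linarith)]
    exact (div_le_one (by linarith)).2 (by linarith)
  rw [← sub_add_cancel (_root_.digamma (x : ℂ)) (∑ j ∈ Finset.range N, _), ← hrec]
  exact (norm_add_le _ _).trans (by linarith [hC (x - N) ⟨by linarith, by linarith⟩])

theorem abs_exp_sub_one_le_mul_exp (x : ℝ) : |Real.exp x - 1| ≤ |x| * Real.exp |x| := by
  rcases le_total 0 x with hx | hx
  · have h1 := Real.one_le_exp hx
    have h2 := Real.add_one_le_exp (-x)
    have h3 : Real.exp (-x) * Real.exp x = 1 := by rw [← Real.exp_add]; simp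
    rw [abs_of_nonneg hx, abs_of_nonneg (by linarith)]
    nlinarith
  · have h1 := Real.exp_le_one_iff.2 hx
    have h2 := Real.add_one_le_exp x
    have h3 := Real.one_le_exp (neg_nonneg.2 hx)
    rw [abs_of_nonpos hx, abs_of_nonpos (by linarith)]
    nlinarith

theorem tendsto_exp_neg_mul_mul_add {c : ℝ} (hc : 0 < c) (A B : ℝ) :
    Tendsto (fun x : ℝ => Real.exp (-(c * x)) * (A + B * x)) atTop (nhds 0) := by
  have h0 : Tendsto (fun x : ℝ => Real.exp (-(c * x))) atTop (nhds 0) :=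
    Real.tendsto_exp_neg_atTop_nhds_zero.comp (tendsto_id.const_mul_atTop hc)
  have h1 : Tendsto (fun x : ℝ => (c * x) ^ 1 * Real.exp (-(c * x))) atTop (nhds 0) :=
    (Real.tendsto_pow_mul_exp_neg_atTop_nhds_zero 1).comp (tendsto_id.const_mul_atTop hc)
  have h := (h0.mul_const A).add (h1.mul_const (B / c))
  simp only [zero_mul, add_zero] at h
  refine h.congr fun x => ?_
  field_simp

theorem abs_sub_floor_add_half_le {b : ℝ} (hb : 0 ≤ b) : |(⌊b + 1 / 2⌋₊ : ℝ) - b| ≤ 1 / 2 := by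
  have h1 := Nat.floor_le (show 0 ≤ b + 1 / 2 by linarith)
  have h2 := Nat.lt_floor_add_one (b + 1 / 2)
  rw [abs_le]
  constructor <;> linarith

theorem half_le_abs_sub_of_ne_floor {b : ℝ} (hb : 0 ≤ b) {n : ℕ} (hn : n ≠ ⌊b + 1 / 2⌋₊) :
    1 / 2 ≤ |(n : ℝ) - b| := by
  have h := abs_sub_floor_add_half_le hb
  have h1 : (1 : ℝ) ≤ |(n : ℝ) - ⌊b + 1 / 2⌋₊| := by
    have := Int.one_le_abs (sub_ne_zero.2 (Nat.cast_injective.ne hn : (n : ℤ) ≠ ⌊b + 1 / 2⌋₊))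
    exact_mod_cast this
  have h2 := abs_sub_le (n : ℝ) b ⌊b + 1 / 2⌋₊
  rw [abs_sub_comm b] at h2
  linarith

/-- The pole of `digamma` closest to `-b` is cancelled by one term of the Lerch series, and what
is left decays as `b → ∞`. -/
theorem tendsto_digamma_neg_add_nearest_term {c : ℝ} (hc : 0 < c) :
    Tendsto (fun b : ℝ => (Real.exp (-(c * b)) : ℂ) * _root_.digamma (-b) +
      (Real.exp (-c) : ℂ) ^ ⌊b + 1 / 2⌋₊ / ((⌊b + 1 / 2⌋₊ : ℂ) - b)) atTop (nhds 0) := by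
  obtain ⟨C, hC0, hC⟩ := exists_norm_digamma_le_on_Icc
  refine squeeze_zero_norm' ?_
    (tendsto_exp_neg_mul_mul_add hc (C + 1 + c * Real.exp c) 2)
  filter_upwards [eventually_ge_atTop 0] with b hb
  have hbound : 0 ≤ Real.exp (-(c * b)) * (C + 1 + c * Real.exp c + 2 * b) := by positivity
  have hk := abs_sub_floor_add_half_le hb
  have hfar := fun n : ℕ => half_le_abs_sub_of_ne_floor hb (n := n)
  have hkb := Nat.floor_le (show 0 ≤ b + 1 / 2 by linarith)
  set k := ⌊b + 1 / 2⌋₊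
  by_cases hint : ∃ m : ℕ, b = m
  · obtain ⟨m, hm⟩ := hint
    have hkm : k = m := by
      by_contra hne
      have := hfar m (Ne.symm hne)
      rw [hm] at this
      norm_num at this
    have hz : _root_.digamma (-(b : ℂ)) = 0 := by
      simp [_root_.digamma, hm, Complex.Gamma_neg_nat_eq_zero]
    rw [hz, hkm, hm]
    simpa [hm] using hbound
  · have hb' (m : ℕ) : b ≠ m := fun h => hint ⟨m, h⟩
    have hkne : (k : ℝ) - b ≠ 0 := fun h => hb' k (by linarith)
    have hrec := digamma_eq_digamma_add_nat_sub_sum (s := -(b : ℂ)) (fun m hm => by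
      exact hb' m (by exact_mod_cast neg_injective hm)) (k + 1)
    have hshift : -(b : ℂ) + (k + 1 : ℕ) = ((k - b + 1 : ℝ) : ℂ) := by push_cast; ring
    rw [hshift, Finset.sum_range_succ] at hrec
    have hψ : ‖_root_.digamma ((k - b + 1 : ℝ) : ℂ)‖ ≤ C := by
      rw [abs_le] at hk
      exact hC _ ⟨by linarith, by linarith⟩
    have hsum : ‖∑ j ∈ Finset.range k, 1 / (-(b : ℂ) + j)‖ ≤ 2 * k := by
      refine (norm_sum_le_of_le (f := fun j : ℕ => 1 / (-(b : ℂ) + j)) _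
        (n := fun _ => (2 : ℝ)) fun j hj => ?_).trans (by simp [mul_comm])
      have hj' := hfar j (Finset.mem_range.1 hj).ne
      have : -(b : ℂ) + j = ((j - b : ℝ) : ℂ) := by push_cast; ring
      rw [this, norm_div, norm_one, Complex.norm_real, Real.norm_eq_abs,
        div_le_iff₀ (by linarith)]
      linarith
    have hpole : |(Real.exp (-(c * k)) - Real.exp (-(c * b))) / (k - b)|
        ≤ Real.exp (-(c * b)) * (c * Real.exp c) := by
      have hfac : Real.exp (-(c * k)) - Real.exp (-(c * b))
          = Real.exp (-(c * b)) * (Real.exp (c * (b - k)) - 1) := by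
        rw [mul_sub, ← Real.exp_add]
        ring_nf
      rw [hfac, abs_div, abs_mul, Real.abs_exp, div_le_iff₀ (abs_pos.2 hkne), mul_assoc]
      refine mul_le_mul_of_nonneg_left ?_ (Real.exp_nonneg _)
      have h := abs_exp_sub_one_le_mul_exp (c * (b - k))
      rw [abs_mul, abs_of_pos hc, abs_sub_comm b] at h
      have h' : Real.exp (c * |(k : ℝ) - b|) ≤ Real.exp c :=
        Real.exp_le_exp.2 (by nlinarith)
      calc _ ≤ _ := h
        _ ≤ c * |(k : ℝ) - b| * Real.exp c := by gcongr
        _ = _ := by ring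
    have hsplit : (Real.exp (-(c * b)) : ℂ) * _root_.digamma (-b) +
        (Real.exp (-c) : ℂ) ^ k / ((k : ℂ) - b) =
        (Real.exp (-(c * b)) : ℂ) * (_root_.digamma ((k - b + 1 : ℝ) : ℂ) -
          ∑ j ∈ Finset.range k, 1 / (-(b : ℂ) + j)) +
        (((Real.exp (-(c * k)) - Real.exp (-(c * b))) / (k - b) : ℝ) : ℂ) := by
      have hpow : (Real.exp (-c) : ℂ) ^ k = (Real.exp (-(c * k)) : ℂ) := by
        rw [← Complex.ofReal_pow, ← Real.exp_nat_mul]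
        ring_nf
      have hcomm : -(b : ℂ) + k = k - b := by ring
      rw [hrec, hpow, hcomm]
      push_cast
      ring
    rw [hsplit]
    refine (norm_add_le _ _).trans ?_
    rw [norm_mul, Complex.norm_real, Complex.norm_real, Real.norm_eq_abs, Real.norm_eq_abs,
      Real.abs_exp]
    have h1 := (norm_sub_le _ _).trans (add_le_add hψ hsum)
    calc _ ≤ Real.exp (-(c * b)) * (C + 2 * k) + Real.exp (-(c * b)) * (c * Real.exp c) := by
          gcongr
      _ ≤ Real.exp (-(c * b)) * (C + 2 * (b + 1 / 2)) + Real.exp (-(c * b)) * (c * Real.exp c) := by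
          gcongr
      _ = _ := by ring

theorem tendsto_digamma_neg_add_lerch {c : ℝ} (hc : 0 < c) :
    Tendsto (fun b : ℝ => (Real.exp (-(c * b)) : ℂ) * _root_.digamma (-b) +
      PhiC (Real.exp (-c)) 1 (-b)) atTop (nhds 0) := by
  have hw0 : 0 < Real.exp (-c) := Real.exp_pos _
  have hw1 : Real.exp (-c) < 1 := Real.exp_lt_one_iff.2 (by linarith)
  have hgeom : Summable fun n : ℕ => 2 * Real.exp (-c) ^ n :=
    (summable_geometric_of_lt_one hw0.le hw1).mul_left 2
  set w := Real.exp (-c)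
  have hterm {b : ℝ} (hb : 0 ≤ b) {n : ℕ} (hn : n ≠ ⌊b + 1 / 2⌋₊) :
      ‖(w : ℂ) ^ n / ((n : ℂ) - b)‖ ≤ 2 * w ^ n := by
    have h := half_le_abs_sub_of_ne_floor hb hn
    rw [← Complex.ofReal_natCast, ← Complex.ofReal_sub, ← Complex.ofReal_pow, norm_div,
      Complex.norm_real, Complex.norm_real, Real.norm_eq_abs, Real.norm_eq_abs,
      abs_of_pos (by positivity), div_le_iff₀ (by linarith)]
    nlinarith [pow_pos hw0 n]
  have hrest : Tendsto (fun b : ℝ => ∑' n : ℕ,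
      if n = ⌊b + 1 / 2⌋₊ then 0 else (w : ℂ) ^ n / ((n : ℂ) - b)) atTop
      (nhds (∑' _ : ℕ, (0 : ℂ))) := by
    refine tendsto_tsum_of_dominated_convergence hgeom (fun n => ?_) ?_
    · have hden : Tendsto (fun b : ℝ => (n : ℂ) - b) atTop (Bornology.cobounded ℂ) := by
        rw [← tendsto_norm_atTop_iff_cobounded]
        refine tendsto_atTop_mono (f := fun b : ℝ => b - n) (fun b => ?_)
          (tendsto_atTop_add_const_right _ _ tendsto_id)
        rw [← Complex.ofReal_natCast, ← Complex.ofReal_sub, Complex.norm_real, Real.norm_eq_abs,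
          abs_sub_comm]
        exact le_abs_self _
      have hlim : Tendsto (fun b : ℝ => (w : ℂ) ^ n / ((n : ℂ) - b)) atTop (nhds 0) := by
        simpa [div_eq_mul_inv] using
          (tendsto_inv₀_cobounded.comp hden).const_mul ((w : ℂ) ^ n)
      refine squeeze_zero_norm (fun b => ?_) (tendsto_zero_iff_norm_tendsto_zero.1 hlim)
      split_ifs
      · simpa using norm_nonneg ((w : ℂ) ^ n / ((n : ℂ) - b))
      · exact le_rfl
    · filter_upwards [eventually_ge_atTop 0] with b hb n
      split_ifs with h
      · simp; positivity
      · exact hterm hb h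
  have h := (tendsto_digamma_neg_add_nearest_term hc).add hrest
  simp only [tsum_zero, add_zero] at h
  refine h.congr' ?_
  filter_upwards [eventually_ge_atTop 0] with b hb
  have hsummable : Summable fun n : ℕ => (w : ℂ) ^ n / ((n : ℂ) - b) := by
    refine Summable.of_norm_bounded_eventually_nat hgeom ?_
    filter_upwards [eventually_gt_atTop ⌊b + 1 / 2⌋₊] with n hn
    exact hterm hb hn.ne'
  rw [PhiC]
  simp only [Complex.cpow_one, ← sub_eq_add_neg]
  rw [hsummable.tsum_eq_add_tsum_ite ⌊b + 1 / 2⌋₊, add_assoc]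

theorem deriv_Zfun_div_Zfun {s : ℂ} (hs : 1 < s.re) :
    deriv Zfun s / Zfun s = -(1 / 2) * (Real.log π : ℂ) + 1 / 2 * _root_.digamma (s / 2) +
      deriv riemannZeta s / riemannZeta s := by
  have hπ : (π : ℂ) ≠ 0 := Complex.ofReal_ne_zero.2 Real.pi_ne_zero
  have hs2 : 0 < (s / 2).re := by
    have : (s / 2).re = s.re / 2 := by simp
    linarith
  have hΓ : DifferentiableAt ℂ Complex.Gamma (s / 2) :=
    Complex.differentiableAt_Gamma _ fun m hm => by
      have : (0 : ℝ) ≤ m := m.cast_nonneg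
      rw [hm] at hs2
      simp at hs2
      linarith
  have hΓ0 := Complex.Gamma_ne_zero_of_re_pos hs2
  have hζ : DifferentiableAt ℂ riemannZeta s :=
    differentiableAt_riemannZeta fun h => by simp [h] at hs
  have hζ0 := riemannZeta_ne_zero_of_one_lt_re hs
  have hdπ : HasDerivAt (fun s : ℂ => (π : ℂ) ^ (-s / 2))
      ((π : ℂ) ^ (-s / 2) * Complex.log π * (-1 / 2)) s :=
    ((hasDerivAt_id s).neg.div_const 2).const_cpow (Or.inl hπ)
  have hdΓ : HasDerivAt (fun s : ℂ => Complex.Gamma (s / 2))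
      (deriv Complex.Gamma (s / 2) * (1 / 2)) s :=
    hΓ.hasDerivAt.comp s ((hasDerivAt_id s).div_const 2)
  have hd := ((hdπ.mul hdΓ).mul hζ.hasDerivAt).deriv
  have hZ : Zfun = ((fun s : ℂ => (π : ℂ) ^ (-s / 2)) * fun s : ℂ => Complex.Gamma (s / 2)) *
    riemannZeta := rfl
  have hπ' : (π : ℂ) ^ (-s / 2) ≠ 0 := by simp [Complex.cpow_eq_zero_iff, hπ]
  rw [hZ, hd, _root_.digamma, Complex.ofReal_log Real.pi_pos.le]
  simp only [Pi.mul_apply]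
  field_simp

theorem tendsto_deriv_riemannZeta_div_riemannZeta :
    Tendsto (fun x : ℝ => deriv riemannZeta x / riemannZeta x) atTop (nhds 0) := by
  have hab : LSeries.abscissaOfAbsConv (fun n => (ArithmeticFunction.vonMangoldt n : ℂ)) < ⊤ :=
    (LSeries.abscissaOfAbsConv_le_of_forall_lt_LSeriesSummable (x := 1) fun y hy =>
      ArithmeticFunction.LSeriesSummable_vonMangoldt (by simpa using hy)).trans_lt
      (EReal.coe_lt_top 1)
  have h := (LSeries.tendsto_atTop hab).neg
  simp only [ArithmeticFunction.vonMangoldt_apply_one, Complex.ofReal_zero, neg_zero] at h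
  refine h.congr' ?_
  filter_upwards [eventually_gt_atTop 1] with x hx
  rw [ArithmeticFunction.LSeries_vonMangoldt_eq_deriv_riemannZeta_div (by simpa using hx)]
  ring

theorem ofReal_digammaR {x : ℝ} (hx : 0 < x) : (digammaR x : ℂ) = _root_.digamma x := by
  have hne (m : ℕ) : x ≠ -m := by
    have : (0 : ℝ) ≤ m := m.cast_nonneg
    linarith
  have h1 := (Real.differentiableAt_Gamma hne).hasDerivAt.ofReal_comp
  have h2 := (Complex.differentiableAt_Gamma (x : ℂ)
    fun m hm => hne m (by exact_mod_cast hm)).hasDerivAt.comp_ofReal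
  simp only [Complex.Gamma_ofReal] at h2
  rw [digammaR, _root_.digamma, Complex.ofReal_div, h1.unique h2, Complex.Gamma_ofReal]

theorem ofReal_PhiR_one (z a : ℝ) : (PhiR z 1 a : ℂ) = PhiC z 1 a := by
  simp [PhiR, PhiC, Complex.ofReal_tsum]

theorem hasDerivAt_exp_mul_PhiR_two {t : ℝ} (ht : 0 < t) :
    HasDerivAt (fun u => Real.exp (-u / 2) * PhiR (Real.exp (-2 * u)) 2 (1 / 4))
      (-2 * (Real.exp (-t / 2) * PhiR (Real.exp (-2 * t)) 1 (1 / 4))) t := by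
  have hexp (u : ℝ) (n : ℕ) : Real.exp (-u / 2) * Real.exp (-2 * u) ^ n
      = Real.exp (-2 * ((n : ℝ) + 1 / 4) * u) := by
    rw [← Real.exp_nat_mul, ← Real.exp_add]
    ring_nf
  have hn (n : ℕ) : (0 : ℝ) < n + 1 / 4 := by positivity
  have hf : (fun u => Real.exp (-u / 2) * PhiR (Real.exp (-2 * u)) 2 (1 / 4)) =
      fun u => ∑' n : ℕ, Real.exp (-2 * ((n : ℝ) + 1 / 4) * u) / ((n : ℝ) + 1 / 4) ^ 2 := by
    funext u
    rw [PhiR, ← tsum_mul_left]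
    refine tsum_congr fun n => ?_
    rw [← mul_div_assoc, hexp]
    norm_cast
  have hf' : -2 * (Real.exp (-t / 2) * PhiR (Real.exp (-2 * t)) 1 (1 / 4)) =
      ∑' n : ℕ, Real.exp (-2 * ((n : ℝ) + 1 / 4) * t) * (-2 * ((n : ℝ) + 1 / 4))
        / ((n : ℝ) + 1 / 4) ^ 2 := by
    rw [PhiR, ← tsum_mul_left, ← tsum_mul_left]
    refine tsum_congr fun n => ?_
    rw [← mul_div_assoc, hexp, Real.rpow_one]
    field_simp [(hn n).ne']
  have hgeom : Summable fun n : ℕ => 8 * Real.exp (-t) ^ n :=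
    (summable_geometric_of_lt_one (Real.exp_nonneg _)
      (Real.exp_lt_one_iff.2 (by linarith))).mul_left 8
  have hle (n : ℕ) {u : ℝ} (hu : t / 2 < u) :
      Real.exp (-2 * ((n : ℝ) + 1 / 4) * u) ≤ Real.exp (-t) ^ n := by
    rw [← Real.exp_nat_mul, Real.exp_le_exp]
    nlinarith [n.cast_nonneg (α := ℝ), mul_nonneg (n.cast_nonneg (α := ℝ)) (sub_nonneg.2 hu.le)]
  rw [hf, hf']
  refine hasDerivAt_tsum_of_isPreconnected
    (g := fun (n : ℕ) (u : ℝ) => Real.exp (-2 * ((n : ℝ) + 1 / 4) * u) / ((n : ℝ) + 1 / 4) ^ 2)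
    (g' := fun (n : ℕ) (u : ℝ) => Real.exp (-2 * ((n : ℝ) + 1 / 4) * u) *
      (-2 * ((n : ℝ) + 1 / 4)) / ((n : ℝ) + 1 / 4) ^ 2)
    (t := Ioi (t / 2)) (y₀ := t) hgeom isOpen_Ioi
    isPreconnected_Ioi (fun n u _ => ?_) (fun n u hu => ?_) (half_lt_self ht) ?_ (half_lt_self ht)
  · have h : HasDerivAt (fun v : ℝ => -2 * ((n : ℝ) + 1 / 4) * v) (-2 * ((n : ℝ) + 1 / 4)) u := by
      simpa using (hasDerivAt_id u).const_mul (-2 * ((n : ℝ) + 1 / 4))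
    exact h.exp.div_const _
  · rw [norm_div, norm_mul, Real.norm_of_nonneg (Real.exp_nonneg _), norm_mul,
      Real.norm_of_nonneg (hn n).le, Real.norm_of_nonneg (sq_nonneg _), norm_neg, Real.norm_two,
      div_le_iff₀ (by positivity)]
    have := hle n hu
    have h4 : (0 : ℝ) ≤ n := n.cast_nonneg
    calc _ ≤ Real.exp (-t) ^ n * (2 * ((n : ℝ) + 1 / 4)) := by gcongr
      _ ≤ Real.exp (-t) ^ n * (8 * ((n : ℝ) + 1 / 4) ^ 2) :=
          mul_le_mul_of_nonneg_left (by nlinarith) (by positivity)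
      _ = _ := by ring
  · refine Summable.of_nonneg_of_le (fun n => by positivity) (fun n => ?_) (hgeom.mul_left 2)
    rw [div_le_iff₀ (by positivity)]
    have := hle n (half_lt_self ht)
    have h4 : (0 : ℝ) ≤ n := n.cast_nonneg
    calc _ ≤ Real.exp (-t) ^ n * 1 := by simpa using this
      _ ≤ Real.exp (-t) ^ n * (16 * ((n : ℝ) + 1 / 4) ^ 2) := by gcongr; nlinarith
      _ = _ := by ring

theorem eventually_floor_exp_eq {t : ℝ} (hn : ∀ n : ℕ, 0 < n → t ≠ Real.log n) :
    ∀ᶠ u in nhds t, ⌊Real.exp u⌋₊ = ⌊Real.exp t⌋₊ := by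
  have hne (n : ℕ) : Real.exp t ≠ n := fun h => by
    have h0 : 0 < n := by
      have := Real.exp_pos t
      rw [h] at this
      exact_mod_cast this
    exact hn n h0 (by rw [← h, Real.log_exp])
  have hlo : (⌊Real.exp t⌋₊ : ℝ) < Real.exp t :=
    lt_of_le_of_ne (Nat.floor_le (Real.exp_nonneg t)) (hne _).symm
  filter_upwards [Real.continuous_exp.continuousAt.eventually (Ioo_mem_nhds hlo
    (Nat.lt_floor_add_one (Real.exp t)))] with u hu
  exact (Nat.floor_eq_iff (Real.exp_nonneg u)).2 ⟨hu.1.le, hu.2⟩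

theorem hasDerivAt_g {t : ℝ} (ht : 0 < t) (hn : ∀ n : ℕ, 0 < n → t ≠ Real.log n) :
    HasDerivAt g (gderiv t) t := by
  have hloc : g =ᶠ[nhds t] fun u => -4 * (Real.exp (u / 2) + Real.exp (-u / 2) - 2)
      - u / 2 * (digammaR (1 / 4) - Real.log π)
      - (1 / 4) * (PhiR 1 2 (1 / 4) - Real.exp (-u / 2) * PhiR (Real.exp (-2 * u)) 2 (1 / 4))
      + ∑ n ∈ Finset.Icc 1 ⌊Real.exp t⌋₊, vM n / Real.sqrt n * (u - Real.log n) := by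
    filter_upwards [eventually_floor_exp_eq hn, lt_mem_nhds ht] with u hu hu0
    rw [g, abs_of_pos hu0, hu]
  refine HasDerivAt.congr_of_eventuallyEq ?_ hloc
  have hid := hasDerivAt_id t
  have h1 : HasDerivAt (fun u : ℝ => Real.exp (u / 2)) (Real.exp (t / 2) * (1 / 2)) t :=
    (hid.div_const 2).exp
  have h2 : HasDerivAt (fun u : ℝ => Real.exp (-u / 2)) (Real.exp (-t / 2) * (-1 / 2)) t :=
    (hid.neg.div_const 2).exp
  have h3 : HasDerivAt (fun u : ℝ => ∑ n ∈ Finset.Icc 1 ⌊Real.exp t⌋₊,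
      vM n / Real.sqrt n * (u - Real.log n))
      (∑ n ∈ Finset.Icc 1 ⌊Real.exp t⌋₊, vM n / Real.sqrt n * 1) t :=
    HasDerivAt.fun_sum fun n _ => (hid.sub_const _).const_mul _
  have h := (((((h1.add h2).sub_const 2).const_mul (-4)).sub
    ((hid.div_const 2).mul_const (digammaR (1 / 4) - Real.log π))).sub
    (((hasDerivAt_exp_mul_PhiR_two ht).const_sub (PhiR 1 2 (1 / 4))).const_mul (1 / 4))).add h3
  refine h.congr_deriv ?_
  simp only [gderiv, mul_one]
  ring

theorem log_lt_of_mem_Icc_floor_exp {t : ℝ} (hn : ∀ n : ℕ, 0 < n → t ≠ Real.log n) {n : ℕ}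
    (h : n ∈ Finset.Icc 1 ⌊Real.exp t⌋₊) : Real.log n < t := by
  obtain ⟨h1, h2⟩ := Finset.mem_Icc.1 h
  have hpos : (0 : ℝ) < n := by exact_mod_cast h1
  refine lt_of_le_of_ne ?_ (hn n h1).symm
  rw [Real.log_le_iff_le_exp hpos]
  exact (Nat.le_floor_iff (Real.exp_nonneg t)).1 h2

theorem tendsto_ofReal_div_one_add_mul {a : ℝ} (ha : a ≠ 0) :
    Tendsto (fun y : ℝ => (y : ℂ) / (1 + a * y)) atTop (nhds (1 / a)) := by
  have h : Tendsto (fun y : ℝ => 1 / (y⁻¹ + a)) atTop (nhds (1 / (0 + a))) :=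
    tendsto_const_nhds.div (tendsto_inv_atTop_zero.add_const a) (by simpa using ha)
  have h' := (Complex.continuous_ofReal.tendsto _).comp h
  rw [zero_add, Complex.ofReal_div, Complex.ofReal_one] at h'
  refine h'.congr' ?_
  filter_upwards [eventually_gt_atTop 0] with y hy
  have hy' : y ≠ 0 := hy.ne'
  have hreal : 1 / (y⁻¹ + a) = y / (1 + a * y) := by
    rw [show y⁻¹ + a = (1 + a * y) / y by field_simp, one_div_div]
  rw [Function.comp_apply, hreal]
  push_cast
  rfl

theorem tendsto_exp_neg_mul_digamma {t : ℝ} (ht : 0 < t) :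
    Tendsto (fun y : ℝ => (Real.exp (-(t * y)) : ℂ) * _root_.digamma (1 / 4 + (y : ℂ) / 2)) atTop
      (nhds 0) := by
  obtain ⟨C, hC⟩ := exists_norm_digamma_le_add
  refine squeeze_zero_norm' ?_ (tendsto_exp_neg_mul_mul_add ht (C + 1 / 4) (1 / 2))
  filter_upwards [eventually_ge_atTop 2] with y hy
  have h := hC (1 / 4 + y / 2) (by linarith)
  push_cast at h
  rw [norm_mul, Complex.norm_real, Real.norm_eq_abs, Real.abs_exp]
  exact mul_le_mul_of_nonneg_left (by linarith) (Real.exp_nonneg _)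

theorem mul_Pfrak_eq (t : ℝ) {y : ℝ} (hy : 1 / 2 < y) :
    (y : ℂ) * Pfrak t (I * (y : ℂ)) - (1 / 2) * _root_.digamma (1 / 4 + (y : ℂ) / 2)
        + (1 / 2) * (Real.log π : ℂ) =
      4 * ((Real.exp (t / 2) : ℂ) - 1) * ((y : ℂ) / (1 + (2 : ℝ) * y))
      + 4 * ((Real.exp (-t / 2) : ℂ) - 1) * ((y : ℂ) / (1 + (-2 : ℝ) * y))
      + ∑ n ∈ Finset.Icc 1 ⌊Real.exp t⌋₊, ((vM n / Real.sqrt n : ℝ) : ℂ) *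
          ((Real.exp (-((t - Real.log n) * y)) : ℂ) - 1)
      + (1 / 2 * (_root_.digamma (1 / 4) - (Real.log π : ℂ))
        + 1 / 2 * (Real.exp (-t / 2) : ℂ) * PhiC (Real.exp (-2 * t)) 1 (1 / 4))
      + (1 - (Real.exp (-(t * y)) : ℂ)) *
        (deriv riemannZeta (y + 1 / 2 : ℝ) / riemannZeta (y + 1 / 2 : ℝ))
      - 1 / 2 * ((Real.exp (-(t * y)) : ℂ) * _root_.digamma (1 / 4 + (y : ℂ) / 2))
      + (Real.log π : ℂ) * (Real.exp (-(t * y)) : ℂ)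
      - 1 / 2 * (Real.exp (-t / 2) : ℂ) *
        ((Real.exp (-(2 * t * (y / 2 - 1 / 4))) : ℂ) * _root_.digamma (-(y / 2 - 1 / 4 : ℝ)) +
          PhiC (Real.exp (-(2 * t))) 1 (-(y / 2 - 1 / 4 : ℝ))) := by
  have hy0 : (y : ℂ) ≠ 0 := Complex.ofReal_ne_zero.2 (by linarith)
  have hI : I * (I * (y : ℂ)) = -y := by rw [← mul_assoc, Complex.I_mul_I]; ring
  have hI2 : 2 * I * (I * (y : ℂ)) = -(2 * y) := by rw [mul_assoc, hI]; ring
  have hIt : I * t * (I * (y : ℂ)) = ((-(t * y) : ℝ) : ℂ) := by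
    push_cast
    linear_combination (t : ℂ) * hI
  have hZ := deriv_Zfun_div_Zfun (s := ((y + 1 / 2 : ℝ) : ℂ)) (by
    rw [Complex.ofReal_re]; linarith)
  have hs : 1 / 2 - -(y : ℂ) = ((y + 1 / 2 : ℝ) : ℂ) := by push_cast; ring
  have hs2 : ((y + 1 / 2 : ℝ) : ℂ) / 2 = 1 / 4 + (y : ℂ) / 2 := by push_cast; ring
  have ha : 1 / 4 + -(y : ℂ) / 2 = -((y / 2 - 1 / 4 : ℝ) : ℂ) := by push_cast; ring
  have ha' : (1 / 2 + -(y : ℂ)) / 2 = -((y / 2 - 1 / 4 : ℝ) : ℂ) := by push_cast; ring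
  have hexp : (Real.exp (-(t * y)) : ℂ) =
      (Real.exp (-t / 2) : ℂ) * (Real.exp (-(2 * t * (y / 2 - 1 / 4))) : ℂ) := by
    rw [← Complex.ofReal_mul, ← Real.exp_add]
    ring_nf
  have hsum : (y : ℂ) * ∑ n ∈ Finset.Icc 1 ⌊Real.exp t⌋₊, ((vM n / Real.sqrt n : ℝ) : ℂ) *
        ((Complex.exp (-(y : ℂ) * ((t : ℝ) - Real.log n)) - 1) / -(y : ℂ)) =
      -∑ n ∈ Finset.Icc 1 ⌊Real.exp t⌋₊, ((vM n / Real.sqrt n : ℝ) : ℂ) *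
          ((Real.exp (-((t - Real.log n) * y)) : ℂ) - 1) := by
    rw [Finset.mul_sum, ← Finset.sum_neg_distrib]
    refine Finset.sum_congr rfl fun n _ => ?_
    have he : -(y : ℂ) * ((t : ℝ) - Real.log n) = ((-((t - Real.log n) * y) : ℝ) : ℂ) := by
      push_cast
      ring
    rw [he, Complex.ofReal_exp]
    field_simp
  have hneg : Real.exp (-2 * t) = Real.exp (-(2 * t)) := by rw [neg_mul]
  rw [Pfrak, hI, hI2, hIt, hs, hZ, hs2, ha, ha', hneg, ← Complex.ofReal_exp]
  set S := ∑ n ∈ Finset.Icc 1 ⌊Real.exp t⌋₊, ((vM n / Real.sqrt n : ℝ) : ℂ) *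
    ((Complex.exp (-(y : ℂ) * ((t : ℝ) - Real.log n)) - 1) / -(y : ℂ))
  have hd1 : 1 - -(2 * (y : ℂ)) = 1 + (2 : ℝ) * y := by push_cast; ring
  have hd2 : 1 + -(2 * (y : ℂ)) = 1 + (-2 : ℝ) * y := by push_cast; ring
  have hinv : (y : ℂ) * (y : ℂ)⁻¹ = 1 := mul_inv_cancel₀ hy0
  rw [hd1, hd2, ← neg_eq_iff_eq_neg.2 hsum, hexp]
  linear_combination
    ((1 - (Real.exp (-t / 2) : ℂ) * (Real.exp (-(2 * t * (y / 2 - 1 / 4))) : ℂ)) *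
        (-(Real.log π : ℂ) + 1 / 2 * _root_.digamma (1 / 4 + (y : ℂ) / 2) +
          deriv riemannZeta (y + 1 / 2 : ℝ) / riemannZeta (y + 1 / 2 : ℝ)) -
      1 / 2 * ((Real.exp (-t / 2) : ℂ) * (Real.exp (-(2 * t * (y / 2 - 1 / 4))) : ℂ)) *
        _root_.digamma (-(y / 2 - 1 / 4 : ℝ)) +
      1 / 2 * _root_.digamma (1 / 4) +
      1 / 2 * (Real.exp (-t / 2) : ℂ) * (PhiC (Real.exp (-(2 * t))) 1 (1 / 4) -
        PhiC (Real.exp (-(2 * t))) 1 (-(y / 2 - 1 / 4 : ℝ)))) * hinv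

/-- Unconditionally, for `t > 0` with `t ≠ log n` for all positive integers `n`,
`lim_{y→+∞} [y 𝔓_t(iy) - (1/2)(Γ'/Γ)(1/4 + y/2) + (1/2) log π] = -g'(t)`,
where `g'(t)` is given by the explicit formula `gderiv t`, the derivative of `g` at `t`. -/
theorem statement13 (t : ℝ) (ht : 0 < t) (hn : ∀ n : ℕ, 0 < n → t ≠ Real.log n) :
    HasDerivAt g (gderiv t) t ∧
    Filter.Tendsto
      (fun y : ℝ => (y : ℂ) * Pfrak t (I * (y : ℂ)) - (1 / 2) * _root_.digamma (1 / 4 + (y : ℂ) / 2)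
        + (1 / 2) * (Real.log π : ℂ))
      Filter.atTop (nhds ((-(gderiv t) : ℝ) : ℂ)) := by
  refine ⟨hasDerivAt_g ht hn, ?_⟩
  have hE : Tendsto (fun y : ℝ => (Real.exp (-(t * y)) : ℂ)) atTop (nhds 0) := by
    have h := (Complex.continuous_ofReal.tendsto 0).comp (tendsto_exp_neg_mul_mul_add ht 1 0)
    simpa [Function.comp_def] using h
  have hsum : Tendsto (fun y : ℝ => ∑ n ∈ Finset.Icc 1 ⌊Real.exp t⌋₊,
      ((vM n / Real.sqrt n : ℝ) : ℂ) * ((Real.exp (-((t - Real.log n) * y)) : ℂ) - 1)) atTop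
      (nhds (∑ n ∈ Finset.Icc 1 ⌊Real.exp t⌋₊, ((vM n / Real.sqrt n : ℝ) : ℂ) * (0 - 1))) := by
    refine tendsto_finsetSum _ fun n hmem => Tendsto.const_mul _ (Tendsto.sub_const ?_ 1)
    have hpos := sub_pos.2 (log_lt_of_mem_Icc_floor_exp hn hmem)
    have h := (Complex.continuous_ofReal.tendsto 0).comp (tendsto_exp_neg_mul_mul_add hpos 1 0)
    simpa [Function.comp_def] using h
  have hζ := tendsto_deriv_riemannZeta_div_riemannZeta.comp
    (tendsto_atTop_add_const_right atTop (1 / 2 : ℝ) tendsto_id)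
  have hpole := (tendsto_digamma_neg_add_lerch (c := 2 * t) (by linarith)).comp
    (tendsto_atTop_add_const_right atTop (-(1 / 4) : ℝ)
      (tendsto_id.atTop_div_const (zero_lt_two (α := ℝ))))
  have hlim := (((((((tendsto_ofReal_div_one_add_mul two_ne_zero).const_mul
      (4 * ((Real.exp (t / 2) : ℂ) - 1))).add
    ((tendsto_ofReal_div_one_add_mul (a := -2) (by norm_num)).const_mul
      (4 * ((Real.exp (-t / 2) : ℂ) - 1)))).add hsum).add_const
    (1 / 2 * (_root_.digamma (1 / 4) - (Real.log π : ℂ))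
        + 1 / 2 * (Real.exp (-t / 2) : ℂ) * PhiC (Real.exp (-2 * t)) 1 (1 / 4))).add
    ((hE.const_sub 1).mul hζ)).sub ((tendsto_exp_neg_mul_digamma ht).const_mul (1 / 2))).add
    (hE.const_mul (Real.log π : ℂ)) |>.sub (hpole.const_mul (1 / 2 * (Real.exp (-t / 2) : ℂ)))
  have hψ := ofReal_digammaR (x := 1 / 4) (by norm_num)
  have hΦ := ofReal_PhiR_one (Real.exp (-2 * t)) (1 / 4)
  push_cast at hψ hΦ
  refine (hlim.congr' ?_).trans_eq (congrArg nhds ?_)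
  · filter_upwards [eventually_gt_atTop (1 / 2)] with y hy
    rw [mul_Pfrak_eq t hy]
    simp only [Function.comp_apply, id, ← sub_eq_add_neg]
  · rw [← Finset.sum_mul, gderiv]
    push_cast
    rw [hψ, hΦ]
    ring
end
end

section
/- Let z ∈ ℂ be such that (1/2 + iz)/2 is not a nonpositive integer. Then lim_{t→0⁺} [ Φ(e^{-2t}, 1, 1/4) - Φ(e^{-2t}, 1, (1/2+iz)/2) ] = -(Γ'/Γ)(1/4) + (Γ'/Γ)((1/2+iz)/2). -/
open MeasureTheory Real Complex Filter Set

noncomputable section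

open scoped Topology

/-- Pointwise convergence of holomorphic functions that are dominated by a continuous function
implies convergence of the derivatives. -/
theorem tendsto_deriv_of_dominated {F : ℕ → ℂ → ℂ} {f : ℂ → ℂ} {B : ℂ → ℝ} {U : Set ℂ} {c : ℂ}
    (hU : IsOpen U) (hc : c ∈ U) (hF : ∀ᶠ n in atTop, DifferentiableOn ℂ (F n) U)
    (hf : DifferentiableOn ℂ f U) (hB : ContinuousOn B U)
    (hFB : ∀ᶠ n in atTop, ∀ w ∈ U, ‖F n w‖ ≤ B w)
    (hlim : ∀ w ∈ U, Tendsto (fun n => F n w) atTop (𝓝 (f w))) :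
    Tendsto (fun n => deriv (F n) c) atTop (𝓝 (deriv f c)) := by
  obtain ⟨R, hR, hRU⟩ := Metric.nhds_basis_closedBall.mem_iff.mp (hU.mem_nhds hc)
  have hmem (θ : ℝ) : circleMap c R θ ∈ U :=
    hRU (Metric.sphere_subset_closedBall (circleMap_mem_sphere c hR.le θ))
  have hne (θ : ℝ) : (circleMap c R θ - c) ^ 2 ≠ 0 :=
    pow_ne_zero 2 (sub_ne_zero.mpr (circleMap_ne_center hR.ne'))
  have hK : Continuous fun θ : ℝ => ((circleMap c R θ - c) ^ 2)⁻¹ :=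
    Continuous.inv₀ (by fun_prop) hne
  have hK' : Continuous (deriv (circleMap c R)) := by
    rw [funext (deriv_circleMap c R)]
    fun_prop
  rw [← Complex.cderiv_eq_deriv hU hf hR hRU]
  refine Tendsto.congr' (hF.mono fun n hn => Complex.cderiv_eq_deriv hU hn hR hRU) ?_
  refine Tendsto.const_smul ?_ _
  refine intervalIntegral.tendsto_integral_filter_of_dominated_convergence
    (fun θ => ‖deriv (circleMap c R) θ‖ *
      (‖((circleMap c R θ - c) ^ 2)⁻¹‖ * B (circleMap c R θ))) ?_ ?_ ?_ ?_
  · filter_upwards [hF] with n hn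
    exact (hK'.smul (hK.smul
      (hn.continuousOn.comp_continuous (continuous_circleMap c R) hmem))).aestronglyMeasurable
  · filter_upwards [hFB] with n hn
    refine ae_of_all _ fun θ _ => ?_
    rw [norm_smul, norm_smul]
    gcongr
    exact hn _ (hmem θ)
  · exact (hK'.norm.mul (hK.norm.mul
      (hB.comp_continuous (continuous_circleMap c R) hmem))).intervalIntegrable _ _
  · exact ae_of_all _ fun θ _ => ((hlim _ (hmem θ)).const_smul _).const_smul _

theorem norm_GammaSeq_le {s : ℂ} (hs : 0 < s.re) {n : ℕ} (hn : n ≠ 0) :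
    ‖Complex.GammaSeq s n‖ ≤ Real.Gamma s.re := by
  rw [Complex.GammaSeq_eq_approx_Gamma_integral hs hn, Real.Gamma_eq_integral hs,
    intervalIntegral.integral_of_le n.cast_nonneg]
  have hint := Real.GammaIntegral_convergent hs
  calc ‖∫ x in Ioc (0 : ℝ) n, (((1 - x / n) ^ n : ℝ) : ℂ) * (x : ℂ) ^ (s - 1)‖
      ≤ ∫ x in Ioc (0 : ℝ) n, Real.exp (-x) * x ^ (s.re - 1) := by
        refine norm_integral_le_of_norm_le (hint.mono_set Ioc_subset_Ioi_self) ?_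
        refine (ae_restrict_iff' measurableSet_Ioc).mpr (ae_of_all _ fun x hx => ?_)
        rw [norm_mul, Complex.norm_of_nonneg (pow_nonneg (sub_nonneg.mpr
          (div_le_one_of_le₀ hx.2 n.cast_nonneg)) _), norm_cpow_eq_rpow_re_of_pos hx.1,
          sub_re, one_re]
        have := Real.rpow_nonneg hx.1.le (s.re - 1)
        gcongr
        exact Real.one_sub_div_pow_le_exp_neg hx.2
    _ ≤ ∫ x in Ioi (0 : ℝ), Real.exp (-x) * x ^ (s.re - 1) := by
        refine setIntegral_mono_set hint ?_ Ioc_subset_Ioi_self.eventuallyLE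
        refine (ae_restrict_iff' measurableSet_Ioi).mpr (ae_of_all _ fun x hx => ?_)
        exact mul_nonneg (Real.exp_pos _).le (Real.rpow_nonneg (le_of_lt hx) _)

theorem hasDerivAt_GammaSeq {s : ℂ} (hs : ∀ m : ℕ, s ≠ -m) {n : ℕ} (hn : n ≠ 0) :
    HasDerivAt (fun w => Complex.GammaSeq w n)
      (Complex.GammaSeq s n *
        (Complex.log n - ∑ j ∈ Finset.range (n + 1), 1 / ((j : ℂ) + s))) s := by
  have hn' : (n : ℂ) ≠ 0 := Nat.cast_ne_zero.mpr hn
  have hj (j : ℕ) : s + j ≠ 0 := fun h => hs j (eq_neg_of_add_eq_zero_left h)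
  have hP : ∏ j ∈ Finset.range (n + 1), (s + (j : ℂ)) ≠ 0 :=
    Finset.prod_ne_zero_iff.mpr fun j _ => hj j
  have hprod : HasDerivAt (fun w : ℂ => ∏ j ∈ Finset.range (n + 1), (w + (j : ℂ)))
      ((∏ j ∈ Finset.range (n + 1), (s + (j : ℂ))) *
        ∑ j ∈ Finset.range (n + 1), 1 / ((j : ℂ) + s)) s := by
    refine (HasDerivAt.fun_finsetProd (u := Finset.range (n + 1)) (f := fun j w => w + (j : ℂ))
      fun j _ => (hasDerivAt_id s).add_const (j : ℂ)).congr_deriv ?_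
    rw [Finset.mul_sum]
    refine Finset.sum_congr rfl fun j hjn => ?_
    rw [← Finset.mul_prod_erase _ _ hjn, add_comm (j : ℂ) s]
    have := hj j
    simp only [smul_eq_mul]
    field_simp
  have hpow : HasDerivAt (fun w : ℂ => (n : ℂ) ^ w * (n.factorial : ℂ))
      ((n : ℂ) ^ s * Complex.log n * 1 * (n.factorial : ℂ)) s :=
    ((hasDerivAt_id s).const_cpow (Or.inl hn')).mul_const _
  refine (hpow.div hprod hP).congr_deriv ?_
  rw [Complex.GammaSeq]
  field_simp

theorem ne_neg_natCast_of_re_pos {s : ℂ} (hs : 0 < s.re) (m : ℕ) : s ≠ -m := by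
  rintro rfl
  simp only [neg_re, natCast_re, Left.neg_pos_iff] at hs
  exact absurd hs (not_lt.mpr m.cast_nonneg)

theorem tendsto_digamma_of_re_pos {s : ℂ} (hs : 0 < s.re) :
    Tendsto (fun n : ℕ => Complex.log n - ∑ j ∈ Finset.range (n + 1), 1 / ((j : ℂ) + s))
      atTop (𝓝 (Complex.digamma s)) := by
  have hderiv : Tendsto (fun n => deriv (fun w => Complex.GammaSeq w n) s) atTop
      (𝓝 (deriv Complex.Gamma s)) := by
    refine tendsto_deriv_of_dominated (U := {w | 0 < w.re}) (B := fun w => Real.Gamma w.re)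
      (isOpen_lt continuous_const continuous_re) hs ?_ ?_ ?_ ?_
      fun w _ => Complex.GammaSeq_tendsto_Gamma w
    · filter_upwards [eventually_ne_atTop 0] with n hn w hw
      exact (hasDerivAt_GammaSeq (ne_neg_natCast_of_re_pos hw) hn).differentiableAt
        |>.differentiableWithinAt
    · exact fun w hw => (Complex.differentiableAt_Gamma w
        (ne_neg_natCast_of_re_pos hw)).differentiableWithinAt
    · intro w hw
      refine ((Real.differentiableAt_Gamma fun m => ?_).continuousAt.comp
        continuous_re.continuousAt).continuousWithinAt
      have : (0 : ℝ) < w.re := hw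
      have := m.cast_nonneg (α := ℝ)
      linarith
    · filter_upwards [eventually_ne_atTop 0] with n hn w hw using norm_GammaSeq_le hw hn
  have hG := Complex.GammaSeq_tendsto_Gamma s
  have hne := Complex.Gamma_ne_zero_of_re_pos hs
  refine (hderiv.div hG hne).congr' ?_
  filter_upwards [eventually_ne_atTop 0, hG.eventually_ne hne] with n hn hn'
  rw [Pi.div_apply, (hasDerivAt_GammaSeq (ne_neg_natCast_of_re_pos hs) hn).deriv,
    mul_div_cancel_left₀ _ hn']

theorem tendsto_one_div_natCast_add (a : ℂ) :
    Tendsto (fun n : ℕ => 1 / ((n : ℂ) + a)) atTop (𝓝 0) := by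
  simp_rw [one_div]
  exact tendsto_inv₀_cobounded.comp
    ((tendsto_add_const_cobounded a).comp tendsto_natCast_atTop_cobounded)

/-- Euler's limit formula for the digamma function. -/
theorem tendsto_digamma {s : ℂ} (hs : ∀ m : ℕ, s ≠ -m) :
    Tendsto (fun n : ℕ => Complex.log n - ∑ j ∈ Finset.range (n + 1), 1 / ((j : ℂ) + s))
      atTop (𝓝 (Complex.digamma s)) := by
  obtain ⟨k, hk⟩ := exists_nat_gt (-s.re)
  induction k generalizing s with
  | zero => exact tendsto_digamma_of_re_pos (by simpa using hk)
  | succ k ih =>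
    have hs' (m : ℕ) : s + 1 ≠ -m := fun h => hs (m + 1) (by push_cast; linear_combination h)
    have h := ih hs' (by push_cast at hk; simp only [add_re, one_re]; linarith)
    rw [Complex.digamma_apply_add_one s hs] at h
    have h' := (h.sub_const s⁻¹).add (tendsto_one_div_natCast_add (s + 1))
    rw [add_sub_cancel_right, add_zero] at h'
    refine h'.congr fun n => ?_
    rw [Finset.sum_range_succ, Finset.sum_range_succ' (fun j : ℕ => 1 / ((j : ℂ) + s))]
    have (j : ℕ) : 1 / (((j + 1 : ℕ) : ℂ) + s) = 1 / ((j : ℂ) + (s + 1)) := by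
      push_cast; ring
    simp only [this, Nat.cast_zero, zero_add, one_div]
    ring

theorem tendsto_sum_one_div_sub_one_div {a b : ℂ} (ha : ∀ m : ℕ, a ≠ -m) (hb : ∀ m : ℕ, b ≠ -m) :
    Tendsto (fun n : ℕ => ∑ j ∈ Finset.range n, (1 / ((j : ℂ) + a) - 1 / ((j : ℂ) + b)))
      atTop (𝓝 (-Complex.digamma a + Complex.digamma b)) := by
  rw [← tendsto_add_atTop_iff_nat 1]
  refine ((tendsto_digamma ha).neg.add (tendsto_digamma hb)).congr fun n => ?_
  rw [Finset.sum_sub_distrib]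
  ring

theorem summable_one_div_mul_pow (a : ℂ) {x : ℂ} (hx : ‖x‖ < 1) :
    Summable fun n : ℕ => 1 / ((n : ℂ) + a) * x ^ n := by
  refine summable_of_isBigO_nat (summable_geometric_of_lt_one (norm_nonneg x) hx) ?_
  have h := ((tendsto_one_div_natCast_add a).isBigO_one ℝ).mul
    (Asymptotics.isBigO_refl (fun n : ℕ => x ^ n) atTop).norm_right
  simpa using h

theorem PhiC_one_sub_PhiC_one (a b : ℂ) {x : ℂ} (hx : ‖x‖ < 1) :
    PhiC x 1 a - PhiC x 1 b =
      ∑' n : ℕ, (1 / ((n : ℂ) + a) - 1 / ((n : ℂ) + b)) * x ^ n := by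
  have h (c : ℂ) : PhiC x 1 c = ∑' n : ℕ, 1 / ((n : ℂ) + c) * x ^ n :=
    tsum_congr fun n => by rw [Complex.cpow_one, div_mul_eq_mul_div, one_mul]
  rw [h, h, ← (summable_one_div_mul_pow a hx).tsum_sub (summable_one_div_mul_pow b hx)]
  simp only [sub_mul]

/-- If `(1/2 + iz)/2` is not a nonpositive integer, then
`lim_{t→0⁺} [Φ(e^{-2t},1,1/4) - Φ(e^{-2t},1,(1/2+iz)/2)] = -(Γ'/Γ)(1/4) + (Γ'/Γ)((1/2+iz)/2)`. -/
theorem statement14 (z : ℂ) (hz : ∀ n : ℕ, (1 / 2 + I * z) / 2 ≠ -(n : ℂ)) :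
    Filter.Tendsto
      (fun t : ℝ => PhiC (Real.exp (-2 * t)) 1 (1 / 4)
        - PhiC (Real.exp (-2 * t)) 1 ((1 / 2 + I * z) / 2))
      (nhdsWithin 0 (Set.Ioi 0))
      (nhds (-_root_.digamma (1 / 4) + _root_.digamma ((1 / 2 + I * z) / 2))) := by
  have hquarter (m : ℕ) : (1 / 4 : ℂ) ≠ -m := ne_neg_natCast_of_re_pos (by norm_num) m
  have hexp : Tendsto (fun t : ℝ => Real.exp (-2 * t)) (𝓝[>] 0) (𝓝[<] 1) := by
    refine tendsto_nhdsWithin_iff.mpr ⟨?_, ?_⟩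
    · have : Continuous fun t : ℝ => Real.exp (-2 * t) := by fun_prop
      simpa using (this.tendsto 0).mono_left nhdsWithin_le_nhds
    · filter_upwards [self_mem_nhdsWithin] with t ht
      exact Real.exp_lt_one_iff.mpr (by linarith [mem_Ioi.mp ht])
  have habel := Complex.tendsto_tsum_powerSeries_nhdsWithin_lt
    (tendsto_sum_one_div_sub_one_div hquarter hz)
  refine ((tendsto_map'_iff.mp habel).comp hexp).congr' ?_
  filter_upwards [self_mem_nhdsWithin] with t ht
  refine (PhiC_one_sub_PhiC_one _ _ ?_).symm
  rw [Complex.norm_of_nonneg (Real.exp_pos _).le]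
  exact Real.exp_lt_one_iff.mpr (by linarith [mem_Ioi.mp ht])
end
end

section
/- Let t ≥ 0, let γ ∈ ℂ with γ ≠ 0, and let z ∈ ℂ with Im z > 0, Im z > Im γ, and z ≠ γ. Then ∫_{-∞}^{∞} φ_{z,t}(x) e^{-iγx} dx = ((e^{iγt} - 1)/γ) · (1/(z - γ)). -/
open MeasureTheory Real Complex Filter Set

noncomputable section

/-- The test function `φ_{z,t}(x) = (iz)⁻¹ e^{izx}(e^{izt} - e^{-iz·min(0,x)}) 1_{(-t,∞)}(x)`. -/
def phiz (z : ℂ) (t : ℝ) (x : ℝ) : ℂ :=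
  (I * z)⁻¹ * Complex.exp (I * z * x) *
    (Complex.exp (I * z * t) - Complex.exp (-(I * z) * (min 0 x : ℝ))) *
    (if -t < x then 1 else 0)

lemma phiz_mul_exp_of_pos {z γ : ℂ} {t x : ℝ} (ht : 0 ≤ t) (hx : 0 < x) :
    phiz z t x * Complex.exp (-I * γ * x)
      = (I * z)⁻¹ * (Complex.exp (I * z * t) - 1) * Complex.exp (I * (z - γ) * x) := by
  have hexp : Complex.exp (I * (z - γ) * x)
      = Complex.exp (I * z * x) * Complex.exp (-I * γ * x) := by
    rw [← Complex.exp_add]; ring_nf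
  rw [phiz, if_pos (by linarith), min_eq_left hx.le, hexp]
  simp only [ofReal_zero, mul_zero, Complex.exp_zero]
  ring

lemma phiz_mul_exp_of_nonpos {z γ : ℂ} {t x : ℝ} (hxt : -t < x) (hx : x ≤ 0) :
    phiz z t x * Complex.exp (-I * γ * x)
      = (I * z)⁻¹ * (Complex.exp (I * z * t) * Complex.exp (I * (z - γ) * x)
          - Complex.exp (-I * γ * x)) := by
  have hexp : Complex.exp (I * (z - γ) * x)
      = Complex.exp (I * z * x) * Complex.exp (-I * γ * x) := by
    rw [← Complex.exp_add]; ring_nf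
  have hcancel : Complex.exp (I * z * x) * Complex.exp (-(I * z) * x) = 1 := by
    rw [← Complex.exp_add]; simp
  rw [phiz, if_pos hxt, min_eq_right hx, hexp]
  linear_combination -(I * z)⁻¹ * Complex.exp (-I * γ * x) * hcancel

lemma phiz_of_le_neg {z : ℂ} {t x : ℝ} (hx : x ≤ -t) : phiz z t x = 0 := by
  rw [phiz, if_neg (not_lt.mpr hx), mul_zero]

/-- For `t ≥ 0`, `γ ≠ 0`, `Im z > 0`, `Im z > Im γ`, `z ≠ γ`:
`∫_ℝ φ_{z,t}(x) e^{-iγx} dx = ((e^{iγt} - 1)/γ)(1/(z-γ))`. -/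
theorem statement15 (t : ℝ) (ht : 0 ≤ t) (γ : ℂ) (hγ : γ ≠ 0) (z : ℂ)
    (hz : 0 < z.im) (hzγ : γ.im < z.im) (hne : z ≠ γ) :
    (∫ x : ℝ, phiz z t x * Complex.exp (-I * γ * x))
      = (Complex.exp (I * γ * t) - 1) / γ * (1 / (z - γ)) := by
  have hz0 : z ≠ 0 := by
    rintro rfl
    simp at hz
  have hw : I * (z - γ) ≠ 0 := mul_ne_zero I_ne_zero (sub_ne_zero.mpr hne)
  have hγ' : -I * γ ≠ 0 := mul_ne_zero (neg_ne_zero.mpr I_ne_zero) hγ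
  have hre : (I * (z - γ)).re < 0 := by simpa using hzγ
  set f : ℝ → ℂ := fun x => phiz z t x * Complex.exp (-I * γ * x) with hf
  have hpos : EqOn f (fun x => (I * z)⁻¹ * (Complex.exp (I * z * t) - 1)
      * Complex.exp (I * (z - γ) * x)) (Ioi 0) := fun x hx => phiz_mul_exp_of_pos ht hx
  have hneg : EqOn f (fun x => (I * z)⁻¹ * (Complex.exp (I * z * t)
      * Complex.exp (I * (z - γ) * x) - Complex.exp (-I * γ * x))) (Ioc (-t) 0) :=
    fun x hx => phiz_mul_exp_of_nonpos hx.1 hx.2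
  have hint_pos : IntegrableOn f (Ioi 0) :=
    IntegrableOn.congr_fun ((integrableOn_exp_mul_complex_Ioi hre 0).const_mul _) hpos.symm
      measurableSet_Ioi
  have hint_neg : IntegrableOn f (Ioc (-t) 0) :=
    IntegrableOn.congr_fun ((by fun_prop : Continuous _).integrableOn_Ioc) hneg.symm
      measurableSet_Ioc
  have hsupp : ∫ x in Ioi (-t), f x = ∫ x, f x := by
    refine setIntegral_eq_integral_of_forall_compl_eq_zero fun x hx => ?_
    simp only [hf, phiz_of_le_neg (not_lt.mp hx), zero_mul]
  rw [← hsupp, ← Ioc_union_Ioi_eq_Ioi (neg_nonpos.mpr ht),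
    setIntegral_union (Ioc_disjoint_Ioi le_rfl) measurableSet_Ioi hint_neg hint_pos,
    setIntegral_congr_fun measurableSet_Ioi hpos, setIntegral_congr_fun measurableSet_Ioc hneg,
    integral_const_mul, integral_const_mul, integral_exp_mul_complex_Ioi hre,
    ← intervalIntegral.integral_of_le (neg_nonpos.mpr ht),
    intervalIntegral.integral_sub (Continuous.intervalIntegrable (by fun_prop) _ _)
      (Continuous.intervalIntegrable (by fun_prop) _ _),
    intervalIntegral.integral_const_mul, integral_exp_mul_complex hw, integral_exp_mul_complex hγ']
  have hprod : Complex.exp (I * z * t) * Complex.exp (I * (z - γ) * (-t : ℝ))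
      = Complex.exp (I * γ * t) := by
    rw [← Complex.exp_add]; push_cast; ring_nf
  have hγt : Complex.exp (-I * γ * (-t : ℝ)) = Complex.exp (I * γ * t) := by
    push_cast; ring_nf
  have hsub : z - γ ≠ 0 := sub_ne_zero.mpr hne
  rw [hγt, mul_div_assoc', mul_sub (Complex.exp (I * z * t)), hprod]
  simp only [ofReal_zero, mul_zero, Complex.exp_zero]
  field_simp
  simp only [I_sq]
  ring
end
end

section
/- Let t ≥ 0 and let z ∈ ℂ with Im z > 1/2. Then ∫_{-∞}^{∞} φ_{z,t}(x)(e^{x/2} + e^{-x/2}) dx = 4(e^{t/2} - 1)/(1 - 2iz) + 4(e^{-t/2} - 1)/(1 + 2iz). -/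
open MeasureTheory Real Complex Filter Set

noncomputable section

/-- `φ_{z,t}(x) e^{ax}` is a combination of truncated exponentials. -/
lemma phiz_mul_exp_eq (z a : ℂ) {t : ℝ} (ht : 0 ≤ t) (x : ℝ) :
    phiz z t x * cexp (a * x)
      = (Ioi (-t)).indicator
          (fun y : ℝ => (I * z)⁻¹ * cexp (I * z * t) * cexp ((I * z + a) * y)) x
        - (Ioi 0).indicator (fun y : ℝ => (I * z)⁻¹ * cexp ((I * z + a) * y)) x
        - (Ioc (-t) 0).indicator (fun y : ℝ => (I * z)⁻¹ * cexp (a * y)) x := by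
  unfold phiz
  rcases le_or_gt x (-t) with h | h
  · have hx : ¬ 0 < x := by linarith
    simp [indicator, not_lt.mpr h, hx]
  · rcases le_or_gt x 0 with hx | hx
    · have key : cexp (I * z * x) * cexp (-(I * z) * x) = 1 := by
        rw [← Complex.exp_add]; simp
      simp only [indicator, mem_Ioi, mem_Ioc, h, hx, not_lt.mpr hx, min_eq_right hx, if_true,
        if_false, and_self, add_mul, Complex.exp_add]
      linear_combination -(I * z)⁻¹ * cexp (a * x) * key
    · simp only [indicator, mem_Ioi, mem_Ioc, h, hx, not_le.mpr hx, min_eq_left hx.le, if_true,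
        if_false, and_false, add_mul, Complex.exp_add, ofReal_zero, mul_zero, Complex.exp_zero]
      ring

/-- The two-sided Laplace transform of `φ_{z,t}`, together with its absolute convergence. -/
lemma integrable_and_integral_phiz_mul_exp {z a : ℂ} (hz : z ≠ 0) (ha : a ≠ 0)
    (hza : (I * z + a).re < 0) {t : ℝ} (ht : 0 ≤ t) :
    Integrable (fun x : ℝ => phiz z t x * cexp (a * x)) ∧
      ∫ x : ℝ, phiz z t x * cexp (a * x) = (cexp (-a * t) - 1) / (a * (I * z + a)) := by
  have h₁ : Integrable ((Ioi (-t)).indicator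
      (fun y : ℝ => (I * z)⁻¹ * cexp (I * z * t) * cexp ((I * z + a) * y))) :=
    (integrable_indicator_iff measurableSet_Ioi).mpr
      ((integrableOn_exp_mul_complex_Ioi hza (-t)).const_mul _)
  have h₂ : Integrable ((Ioi (0 : ℝ)).indicator
      (fun y : ℝ => (I * z)⁻¹ * cexp ((I * z + a) * y))) :=
    (integrable_indicator_iff measurableSet_Ioi).mpr
      ((integrableOn_exp_mul_complex_Ioi hza 0).const_mul _)
  have h₃ : Integrable ((Ioc (-t) 0).indicator
      (fun y : ℝ => (I * z)⁻¹ * cexp (a * y))) :=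
    (integrable_indicator_iff measurableSet_Ioc).mpr
      (Continuous.integrableOn_Ioc (by fun_prop))
  have hne : I * z + a ≠ 0 := fun h => by simp [h] at hza
  simp only [phiz_mul_exp_eq z a ht]
  refine ⟨(h₁.sub h₂).sub h₃, ?_⟩
  refine (integral_sub (h₁.sub h₂) h₃).trans ?_
  rw [integral_sub' h₁ h₂, integral_indicator measurableSet_Ioi,
    integral_indicator measurableSet_Ioi, integral_indicator measurableSet_Ioc,
    integral_const_mul, integral_const_mul, integral_const_mul,
    integral_exp_mul_complex_Ioi hza, integral_exp_mul_complex_Ioi hza,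
    ← intervalIntegral.integral_of_le (by linarith), integral_exp_mul_complex ha]
  have key : cexp (I * z * t) * cexp ((I * z + a) * (-t : ℝ)) = cexp (-a * t) := by
    rw [← Complex.exp_add]; congr 1; push_cast; ring
  have key' : cexp (a * (-t : ℝ)) = cexp (-a * t) := by congr 1; push_cast; ring
  rw [key', show (I * z)⁻¹ * cexp (I * z * t) * (-cexp ((I * z + a) * (-t : ℝ)) / (I * z + a))
    = -(I * z)⁻¹ * (cexp (I * z * t) * cexp ((I * z + a) * (-t : ℝ))) / (I * z + a) by ring, key]
  simp only [ofReal_zero, mul_zero, Complex.exp_zero]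
  have hI := I_ne_zero
  field_simp
  ring

/-- For `t ≥ 0` and `Im z > 1/2`:
`∫_ℝ φ_{z,t}(x)(e^{x/2} + e^{-x/2}) dx = 4(e^{t/2}-1)/(1-2iz) + 4(e^{-t/2}-1)/(1+2iz)`. -/
theorem statement16 (t : ℝ) (ht : 0 ≤ t) (z : ℂ) (hz : 1 / 2 < z.im) :
    (∫ x : ℝ, phiz z t x * ((Real.exp (x / 2) + Real.exp (-x / 2) : ℝ) : ℂ))
      = 4 * ((Real.exp (t / 2) : ℂ) - 1) / (1 - 2 * I * z)
        + 4 * ((Real.exp (-t / 2) : ℂ) - 1) / (1 + 2 * I * z) := by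
  have hz0 : z ≠ 0 := fun h => by norm_num [h] at hz
  obtain ⟨i₁, e₁⟩ := integrable_and_integral_phiz_mul_exp (z := z) (a := 1 / 2) hz0
    (by norm_num) (by simp; linarith) ht
  obtain ⟨i₂, e₂⟩ := integrable_and_integral_phiz_mul_exp (z := z) (a := -1 / 2) hz0
    (by norm_num) (by simp; linarith) ht
  have hsplit : ∀ x : ℝ, phiz z t x * ((Real.exp (x / 2) + Real.exp (-x / 2) : ℝ) : ℂ)
      = phiz z t x * cexp (1 / 2 * x) + phiz z t x * cexp (-1 / 2 * x) := fun x => by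
    push_cast
    rw [mul_add]
    congr 4 <;> ring
  simp only [hsplit]
  rw [integral_add i₁ i₂, e₁, e₂, add_comm]
  push_cast
  rw [show -(-1 / 2 : ℂ) * t = t / 2 by ring, show -(1 / 2 : ℂ) * t = -t / 2 by ring,
    show (-1 / 2 : ℂ) * (I * z + -1 / 2) = (1 - 2 * I * z) / 4 by ring,
    show (1 / 2 : ℂ) * (I * z + 1 / 2) = (1 + 2 * I * z) / 4 by ring,
    div_div_eq_mul_div, div_div_eq_mul_div]
  ring
end
end

section
/- Let t ≥ 0 and let z ∈ ℂ with Im z > 1/2. Then ∑_{n=1}^{∞} (Λ(n)/√n)·φ_{z,t}(log n) = -((e^{izt} - 1)/(iz)) · (ζ'/ζ)(1/2 - iz), and ∑_{n=1}^{∞} (Λ(n)/√n)·φ_{z,t}(-log n) = ∑_{n ≤ e^t} (Λ(n)/√n) · (e^{iz(t - log n)} - 1)/(iz), where the latter sum is finite. -/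
open MeasureTheory Real Complex Filter Set

noncomputable section

/-- For `x ≥ 0` with `-t < x`,
`φ_{z,t}(x) = (e^{izt} - 1) / (iz) · e^{izx}`. -/
theorem phiz_of_nonneg {z : ℂ} {t x : ℝ} (hx : 0 ≤ x) (htx : -t < x) :
    phiz z t x = (Complex.exp (I * z * t) - 1) / (I * z) * Complex.exp (I * z * x) := by
  simp only [phiz, min_eq_left hx, htx, if_true, ofReal_zero, mul_zero, Complex.exp_zero]
  ring

/-- For `0 ≤ x ≤ t`, `φ_{z,t}(-x) = (e^{iz(t-x)} - 1) / (iz)`. -/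
theorem phiz_neg_of_le {z : ℂ} {t x : ℝ} (hx : 0 ≤ x) (hxt : x ≤ t) :
    phiz z t (-x) = (Complex.exp (I * z * (t - x)) - 1) / (I * z) := by
  have hmin : min 0 (-x) = -x := min_eq_right (by linarith)
  have hsub : Complex.exp (I * z * (-x : ℝ)) *
      (Complex.exp (I * z * t) - Complex.exp (-(I * z) * (-x : ℝ))) =
        Complex.exp (I * z * (t - x)) - 1 := by
    rw [mul_sub, ← Complex.exp_add, ← Complex.exp_add]
    congr 1
    · congr 1
      push_cast
      ring
    · rw [← Complex.exp_zero]
      congr 1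
      ring
  rcases hxt.lt_or_eq with h | rfl
  · rw [phiz, hmin, if_pos (by linarith), mul_assoc (I * z)⁻¹, hsub]
    ring
  · simp [phiz]

/-- `φ_{z,t}` vanishes at `-x` for `x > t`. -/
theorem phiz_neg_of_lt {z : ℂ} {t x : ℝ} (hxt : t < x) : phiz z t (-x) = 0 := by
  simp [phiz, hxt.le]

/-- `e^{iz log n} / √n = 1 / n^{1/2 - iz}`. -/
theorem inv_sqrt_mul_exp_log {n : ℕ} (hn : n ≠ 0) (z : ℂ) :
    ((Real.sqrt n : ℝ) : ℂ)⁻¹ * Complex.exp (I * z * (Real.log n : ℝ)) =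
      ((n : ℂ) ^ (1 / 2 - I * z))⁻¹ := by
  have hn' : (n : ℂ) ≠ 0 := Nat.cast_ne_zero.mpr hn
  have hsqrt : ((Real.sqrt n : ℝ) : ℂ) = (n : ℂ) ^ (1 / 2 : ℂ) := by
    rw [Real.sqrt_eq_rpow, Complex.ofReal_cpow n.cast_nonneg]
    push_cast
    rfl
  rw [hsqrt, ← Complex.cpow_neg, ← Complex.cpow_neg, Complex.cpow_def_of_ne_zero hn',
    Complex.cpow_def_of_ne_zero hn', ← Complex.exp_add, ← Complex.natCast_log]
  congr 1
  ring

/-- For `t ≥ 0` and `Im z > 1/2`: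
`∑_{n≥1} (Λ(n)/√n) φ_{z,t}(log n) = -((e^{izt}-1)/(iz)) (ζ'/ζ)(1/2-iz)` and
`∑_{n≥1} (Λ(n)/√n) φ_{z,t}(-log n) = ∑_{n ≤ e^t} (Λ(n)/√n)(e^{iz(t-log n)}-1)/(iz)`. -/
theorem statement17 (t : ℝ) (ht : 0 ≤ t) (z : ℂ) (hz : 1 / 2 < z.im) :
    (∑' n : ℕ, ((vM n / Real.sqrt n : ℝ) : ℂ) * phiz z t (Real.log n))
        = -((Complex.exp (I * z * t) - 1) / (I * z)) *
            (deriv riemannZeta (1 / 2 - I * z) / riemannZeta (1 / 2 - I * z)) ∧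
    (∑' n : ℕ, ((vM n / Real.sqrt n : ℝ) : ℂ) * phiz z t (-Real.log n))
        = ∑ n ∈ Finset.Icc 1 ⌊Real.exp t⌋₊,
            ((vM n / Real.sqrt n : ℝ) : ℂ) *
              ((Complex.exp (I * z * ((t : ℝ) - Real.log n)) - 1) / (I * z)) := by
  constructor
  · have hs : 1 < (1 / 2 - I * z).re := by
      simp only [sub_re, mul_re, I_re, I_im]
      norm_num
      linarith
    have hL := ArithmeticFunction.LSeries_vonMangoldt_eq_deriv_riemannZeta_div hs
    rw [LSeries] at hL
    rw [neg_mul, ← mul_neg, ← neg_div, ← hL, ← tsum_mul_left]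
    congr 1
    funext n
    rcases le_or_gt n 1 with hn | hn
    · interval_cases n <;> simp [vM, LSeries.term]
    · have hlog : 0 < Real.log n := Real.log_pos (by exact_mod_cast hn)
      rw [phiz_of_nonneg hlog.le (by linarith), LSeries.term_of_ne_zero (by omega),
        div_eq_mul_inv _ ((n : ℂ) ^ _), ← inv_sqrt_mul_exp_log (by omega), vM]
      push_cast
      ring
  · have hmem {n : ℕ} (hn : n ≠ 0) :
        n ∈ Finset.Icc 1 ⌊Real.exp t⌋₊ ↔ Real.log n ≤ t := by
      rw [Finset.mem_Icc, Nat.le_floor_iff (Real.exp_pos t).le,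
        Real.log_le_iff_le_exp (by positivity)]
      exact and_iff_right (Nat.one_le_iff_ne_zero.mpr hn)
    rw [tsum_eq_sum (s := Finset.Icc 1 ⌊Real.exp t⌋₊)]
    · refine Finset.sum_congr rfl fun n hn ↦ ?_
      have hn0 : n ≠ 0 := by
        have := (Finset.mem_Icc.mp hn).1
        omega
      rw [phiz_neg_of_le (Real.log_natCast_nonneg n) ((hmem hn0).mp hn)]
    · intro n hn
      rcases eq_or_ne n 0 with rfl | hn0
      · simp
      · rw [phiz_neg_of_lt (not_le.mp (mt (hmem hn0).mpr hn)), mul_zero]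
end
end
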